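/- Define r(v0,A) := −∫ Σ_{{i,j}∈E} (w_{ij} / Σ_{e∈E} w_e) · log( w_{ij} / √(w_i·w_j) ) dμ_{v0,A}(w). Then r(v0,A) ≤ Σ_{e={i,j}∈E} ( (a_e/2) · Γ(b_i)/Γ(b_i+1/2) · Γ(b_j)/Γ(b_j+1/2) ) · ( log 2 + (1/2)·Ψ(b_i+1/2) + (1/2)·Ψ(b_j+1/2) − Ψ(a_e+1) ), where Ψ = (log Γ)′ is the digamma function. -/

import Mathlib

open MeasureTheory Real Filter
open scoped ENNReal NNReal Classical BigOperators

noncomputable section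

namespace ERRW

variable {V : Type*} [Fintype V] [DecidableEq V]

/-- Total weight at a vertex: sum of the edge weights over the edges incident to `i`. -/
def vw (G : SimpleGraph V) [DecidableRel G.Adj] (w : Sym2 V → ℝ) (i : V) : ℝ :=
  ∑ j ∈ G.neighborFinset i, w s(i, j)

/-- Product of a vertex function over the two endpoints of an unordered pair. -/
def sprod (f : V → ℝ) : Sym2 V → ℝ :=
  Sym2.lift ⟨fun i j => f i * f j, fun i j => mul_comm _ _⟩

/-- Sum of a vertex function over the two endpoints of an unordered pair. -/
def ssum (f : V → ℝ) : Sym2 V → ℝ :=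
  Sym2.lift ⟨fun i j => f i + f j, fun i j => add_comm _ _⟩

/-- Quenched transition probability `p_{ij}(w) = w_{ij}/w_i`. -/
def qstep (G : SimpleGraph V) [DecidableRel G.Adj] (w : Sym2 V → ℝ) (i j : V) : ℝ :=
  if G.Adj i j then w s(i, j) / vw G w i else 0

/-- Stationary distribution `π_i(w) = w_i / Σ_v w_v` of the quenched chain. -/
def statDist (G : SimpleGraph V) [DecidableRel G.Adj] (w : Sym2 V → ℝ) (i : V) : ℝ :=
  vw G w i / ∑ v : V, vw G w v

/-- Spanning trees of `G`, as edge sets. -/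
def spanningTrees (G : SimpleGraph V) [DecidableRel G.Adj] : Finset (Finset (Sym2 V)) :=
  G.edgeFinset.powerset.filter fun F =>
    (SimpleGraph.fromEdgeSet (F : Set (Sym2 V))).IsTree

/-- Spanning-tree polynomial `τ(w) = Σ_{T} Π_{e ∈ T} w_e`. -/
def tau (G : SimpleGraph V) [DecidableRel G.Adj] (w : Sym2 V → ℝ) : ℝ :=
  ∑ F ∈ spanningTrees G, ∏ e ∈ F, w e

/-- Vertex parameter `b_v = (B_v + 1 - 𝟙(v = x))/2`. -/
def bwt (G : SimpleGraph V) [DecidableRel G.Adj] (x : V) (B : Sym2 V → ℝ) (v : V) : ℝ :=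
  (vw G B v + 1 - if v = x then 1 else 0) / 2

/-- The normalizing constant `Z_{x,B}` of the magic formula. -/
def Znorm (G : SimpleGraph V) [DecidableRel G.Adj] (x : V) (B : Sym2 V → ℝ) : ℝ :=
  ((∏ e ∈ G.edgeFinset, Real.Gamma (B e)) /
      ∏ v : V, Real.Gamma (bwt G x B v)) *
    Real.pi ^ (((Fintype.card V : ℝ) - 1) / 2) /
    2 ^ ((1 : ℝ) - (Fintype.card V : ℝ) + ∑ e ∈ G.edgeFinset, B e)

/-- The magic-formula density of `μ_{x,B}` with respect to `Π_{e ≠ e0} dw_e`. -/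
def magicDensity (G : SimpleGraph V) [DecidableRel G.Adj] (x : V) (B : Sym2 V → ℝ)
    (w : Sym2 V → ℝ) : ℝ :=
  (Znorm G x B)⁻¹ * (vw G w x) ^ ((1 : ℝ) / 2) *
      (∏ e ∈ G.edgeFinset, w e ^ (B e - 1)) /
      (∏ v : V, (vw G w v) ^ ((vw G B v + 1) / 2)) *
    Real.sqrt (tau G w)

/-- Coordinates indexed by the non-reference edges. -/
abbrev Epin (G : SimpleGraph V) [DecidableRel G.Adj] (e0 : Sym2 V) :=
  {e : Sym2 V // e ∈ G.edgeFinset ∧ e ≠ e0}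

/-- Extension of non-reference edge coordinates to a pinned environment (`w_{e0} = 1`). -/
def pinExt (G : SimpleGraph V) [DecidableRel G.Adj] (e0 : Sym2 V)
    (u : Epin G e0 → ℝ) : Sym2 V → ℝ :=
  fun e => if e = e0 then 1 else if h : e ∈ G.edgeFinset ∧ e ≠ e0 then u ⟨e, h⟩ else 0

/-- The mixing measure `μ_{x,B}` of the magic formula, as a measure on
environments pinned at the reference edge `e0`. -/
def mixing (G : SimpleGraph V) [DecidableRel G.Adj] (e0 : Sym2 V) (x : V) (B : Sym2 V → ℝ) :
    Measure (Sym2 V → ℝ) :=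
  Measure.map (pinExt G e0)
    ((volume : Measure (Epin G e0 → ℝ)).withDensity fun u =>
      ENNReal.ofReal
        (if ∀ e ∈ G.edgeFinset, 0 < pinExt G e0 u e then
          magicDensity G x B (pinExt G e0 u) else 0))

/-- Kullback–Leibler divergence (natural logarithm), `+∞` if `P` is not
absolutely continuous with respect to `Q`. -/
def KL {Ω : Type*} [MeasurableSpace Ω] (P Q : Measure Ω) : EReal :=
  if P ≪ Q then ((∫ x, Real.log (P.rnDeriv Q x).toReal ∂P : ℝ) : EReal) else ⊤

/-- Edge local time (current edge weight) at time `t` along a path. -/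
def localTime (a : Sym2 V → ℝ) (x : ℕ → V) (t : ℕ) (e : Sym2 V) : ℝ :=
  a e + ((Finset.range t).filter fun k => s(x k, x (k + 1)) = e).card

/-- One-step ERRW conditional probability at time `t` given the past of the path. -/
def errwStep (G : SimpleGraph V) [DecidableRel G.Adj] (a : Sym2 V → ℝ) (x : ℕ → V)
    (t : ℕ) : ℝ :=
  if G.Adj (x t) (x (t + 1)) then
    localTime a x t s(x t, x (t + 1)) /
      ∑ u ∈ G.neighborFinset (x t), localTime a x t s(x t, u)
  else 0

/-- Extension of a finite path to ℕ (junk value `v0` beyond time `T`). -/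
def extendPath {T : ℕ} (v0 : V) (x : Fin (T + 1) → V) : ℕ → V :=
  fun t => if h : t < T + 1 then x ⟨t, h⟩ else v0

/-- ERRW trajectory probability of a length-`T` path (the trajectory law mass function). -/
def errwProb (G : SimpleGraph V) [DecidableRel G.Adj] (v0 : V) (a : Sym2 V → ℝ) (T : ℕ)
    (x : Fin (T + 1) → V) : ℝ :=
  if x 0 = v0 then ∏ t ∈ Finset.range T, errwStep G a (extendPath v0 x) t else 0

/-- Undirected traversal count `N_e` of an edge along a finite path. -/
def edgeCount {T : ℕ} (v0 : V) (x : Fin (T + 1) → V) (e : Sym2 V) : ℕ :=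
  ((Finset.range T).filter fun k =>
    s(extendPath v0 x k, extendPath v0 x (k + 1)) = e).card

/-- Quenched path probability of a length-`T` path started at `v0`. -/
def quenchedProb (G : SimpleGraph V) [DecidableRel G.Adj] (v0 : V) (w : Sym2 V → ℝ) (T : ℕ)
    (x : Fin (T + 1) → V) : ℝ :=
  if x 0 = v0 then
    ∏ t ∈ Finset.range T, qstep G w (extendPath v0 x t) (extendPath v0 x (t + 1))
  else 0

/-- The measure on a finite type determined by a mass function. -/
def discreteMeasure {Ω : Type*} [Fintype Ω] [MeasurableSpace Ω] (p : Ω → ℝ) : Measure Ω :=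
  ∑ x : Ω, ENNReal.ofReal (p x) • Measure.dirac x

/-- Digamma function `Ψ = (log Γ)'`. -/
def digamma (x : ℝ) : ℝ := deriv (fun y => Real.log (Real.Gamma y)) x

/-- Trigamma function `Ψ₁ = Ψ'`. -/
def trigamma (x : ℝ) : ℝ := deriv digamma x

/-- `Λ(p,q) = log Γ(q) − log Γ(p) − (q−p)·Ψ(p)`. -/
def Lam (p q : ℝ) : ℝ :=
  Real.log (Real.Gamma q) - Real.log (Real.Gamma p) - (q - p) * digamma p


/-- Expansion of the determinant of a weighted sum of rank-one matrices (Cauchy–Binet). -/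
lemma det_sum_smul_vecMulVec {ι n R : Type*} [Fintype ι] [DecidableEq ι] [Fintype n]
    [DecidableEq n] [CommRing R] (b : ι → n → R) (w : ι → R) :
    (∑ e, w e • Matrix.vecMulVec (b e) (b e)).det =
      ∑ S ∈ Finset.powersetCard (Fintype.card n) Finset.univ,
        (∏ e ∈ S, w e) * (∑ e ∈ S, Matrix.vecMulVec (b e) (b e)).det := by
  set c : (n → ι) → R := fun f =>
    (∏ i, b (f i) i) * Matrix.detRowAlternating (fun i => b (f i)) with hc
  have hc0 : ∀ f : n → ι, ¬ Function.Injective f → c f = 0 := by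
    intro f hf
    simp only [Function.Injective, not_forall] at hf
    obtain ⟨i, j, hij, hne⟩ := hf
    rw [hc]
    simp only
    rw [AlternatingMap.map_eq_zero_of_eq _ _ (by simp [hij]) hne, mul_zero]
  have key : ∀ v : ι → R, (∑ e, v e • Matrix.vecMulVec (b e) (b e)).det =
      ∑ S : Finset ι, (∑ f : n → ι with Finset.univ.image f = S, c f) * ∏ e ∈ S, v e := by
    intro v
    have h1 : (∑ e, v e • Matrix.vecMulVec (b e) (b e)).det =
        ∑ f : n → ι, c f * ∏ i, v (f i) := by
      have h2 : (∑ e, v e • Matrix.vecMulVec (b e) (b e)) =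
          fun i => ∑ e, (v e * b e i) • b e := by
        ext i j
        simp [Matrix.sum_apply, Matrix.vecMulVec_apply, mul_assoc]
      rw [h2]
      change Matrix.detRowAlternating _ = _
      have := (Matrix.detRowAlternating (n := n) (R := R)).toMultilinearMap.map_sum
        (fun (i : n) (e : ι) => (v e * b e i) • b e)
      simp only [AlternatingMap.coe_multilinearMap] at this
      rw [this]
      refine Finset.sum_congr rfl fun f _ => ?_
      have h3 := (Matrix.detRowAlternating (n := n) (R := R)).toMultilinearMap.map_smul_univ
        (fun i => v (f i) * b (f i) i) (fun i => b (f i))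
      simp only [AlternatingMap.coe_multilinearMap] at h3
      rw [h3, hc, smul_eq_mul, Finset.prod_mul_distrib]
      ring
    rw [h1, ← Finset.sum_fiberwise (s := Finset.univ)
      (g := fun f : n → ι => Finset.univ.image f)]
    refine Finset.sum_congr rfl fun S _ => ?_
    rw [Finset.sum_mul]
    refine Finset.sum_congr rfl fun f hf => ?_
    by_cases hinj : Function.Injective f
    · rw [← (Finset.mem_filter.1 hf).2, Finset.prod_image (fun _ _ _ _ h => hinj h)]
    · rw [hc0 f hinj, zero_mul, zero_mul]
  have hC : ∀ S : Finset ι, S.card ≠ Fintype.card n →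
      (∑ f : n → ι with Finset.univ.image f = S, c f) = 0 := by
    intro S hS
    refine Finset.sum_eq_zero fun f hf => hc0 f fun hinj => hS ?_
    rw [← (Finset.mem_filter.1 hf).2, Finset.card_image_of_injective _ hinj, Finset.card_univ]
  have hS : ∀ S : Finset ι, S.card = Fintype.card n →
      (∑ e ∈ S, Matrix.vecMulVec (b e) (b e)).det =
        ∑ f : n → ι with Finset.univ.image f = S, c f := by
    intro S hS
    have h := key (fun e => if e ∈ S then 1 else 0)
    have h1 : (∑ e, (if e ∈ S then (1 : R) else 0) • Matrix.vecMulVec (b e) (b e)) =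
        ∑ e ∈ S, Matrix.vecMulVec (b e) (b e) := by
      simp [ite_smul]
    rw [h1] at h
    rw [h, Finset.sum_eq_single S]
    · rw [Finset.prod_eq_one (fun e he => by simp [he]), mul_one]
    · intro T _ hT
      by_cases hcard : T.card = Fintype.card n
      · have : ∃ e ∈ T, e ∉ S := by
          by_contra! hsub
          exact hT (Finset.eq_of_subset_of_card_le hsub (by rw [hcard, hS]))
        obtain ⟨e, he, he'⟩ := this
        rw [Finset.prod_eq_zero he (by simp [he']), mul_zero]
      · rw [hC T hcard, zero_mul]
    · simp
  rw [key, ← Finset.sum_subset (Finset.subset_univ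
    (Finset.powersetCard (Fintype.card n) (Finset.univ : Finset ι)))]
  · refine Finset.sum_congr rfl fun S hS' => ?_
    rw [hS S (Finset.mem_powersetCard.1 hS').2, mul_comm]
  · intro S _ hS'
    rw [hC S (fun h => hS' (Finset.mem_powersetCard.2 ⟨Finset.subset_univ _, h⟩)), zero_mul]

/-- Signed incidence vector of an unordered pair, for an arbitrary orientation. -/
def inc (e : Sym2 V) (v : V) : ℤ :=
  (if v = (Quot.out e).1 then 1 else 0) - (if v = (Quot.out e).2 then 1 else 0)

lemma exists_sign_inc (p q : V) : ∃ ε : ℤ, ε * ε = 1 ∧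
    ∀ v, inc s(p, q) v = ε * ((if v = p then 1 else 0) - (if v = q then 1 else 0)) := by
  have h : s((Quot.out s(p, q)).1, (Quot.out s(p, q)).2) = s(p, q) := Quot.out_eq s(p, q)
  rcases Sym2.eq_iff.1 h with ⟨h1, h2⟩ | ⟨h1, h2⟩
  · exact ⟨1, by norm_num, fun v => by rw [inc, h1, h2, one_mul]⟩
  · exact ⟨-1, by norm_num, fun v => by rw [inc, h1, h2]; ring⟩

lemma inc_mul_inc (p q i j : V) : inc s(p, q) i * inc s(p, q) j =
    ((if i = p then 1 else 0) - (if i = q then 1 else 0)) *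
      ((if j = p then 1 else 0) - (if j = q then 1 else 0)) := by
  obtain ⟨ε, hε, h⟩ := exists_sign_inc p q
  rw [h, h]
  linear_combination ((((if i = p then 1 else 0) - (if i = q then 1 else 0)) *
      ((if j = p then 1 else 0) - (if j = q then 1 else 0)) : ℤ)) * hε

/-- The incidence vector restricted to the vertices other than `x`. -/
abbrev rinc (x : V) (e : Sym2 V) (v : {v : V // v ≠ x}) : ℤ := inc e v

lemma sum_rinc_mul (x p q : V) (h : V → ℤ) (hx : h x = 0)
    (hpq : h p = h q) : ∑ v : {v : V // v ≠ x}, rinc x s(p, q) v * h v = 0 := by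
  obtain ⟨ε, hε, hi⟩ := exists_sign_inc p q
  have h1 : ∑ v : {v : V // v ≠ x}, rinc x s(p, q) v * h v = ∑ v : V, inc s(p, q) v * h v := by
    refine (Finset.sum_subtype (Finset.univ.filter (· ≠ x)) (by simp)
      (fun v => inc s(p, q) v * h v)).symm.trans ?_
    refine Finset.sum_subset (Finset.subset_univ _) fun v _ hv => ?_
    have : v = x := by simpa using hv
    rw [this, hx, mul_zero]
  rw [h1]
  simp only [hi, mul_assoc, sub_mul, ite_mul, one_mul, zero_mul, ← Finset.mul_sum,
    Finset.sum_sub_distrib, Finset.sum_ite_eq', Finset.mem_univ, if_true, hpq, sub_self, mul_zero]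

lemma det_sum_rinc_of_not_connected (x : V) (S : Finset (Sym2 V))
    (hS : ¬ (SimpleGraph.fromEdgeSet (S : Set (Sym2 V))).Connected) :
    (∑ e ∈ S, Matrix.vecMulVec (rinc x e) (rinc x e)).det = 0 := by
  set T := SimpleGraph.fromEdgeSet (S : Set (Sym2 V)) with hT
  have : ∃ y, ¬ T.Reachable x y := by
    by_contra! h
    exact hS ((SimpleGraph.connected_iff_exists_forall_reachable T).2 ⟨x, h⟩)
  obtain ⟨y, hy⟩ := this
  have hyx : y ≠ x := by rintro rfl; exact hy (SimpleGraph.Reachable.refl _)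
  set h : V → ℤ := fun v => if T.Reachable x v then 0 else 1 with hh
  have hx : h x = 0 := by simp [hh]
  rw [← Matrix.exists_mulVec_eq_zero_iff]
  refine ⟨fun v => h v, fun h0 => ?_, ?_⟩
  · have := congrFun h0 ⟨y, hyx⟩
    simp [hh, hy] at this
  · ext i
    simp only [Matrix.mulVec, dotProduct, Matrix.sum_apply, Matrix.vecMulVec_apply,
      Finset.sum_mul, Pi.zero_apply]
    rw [Finset.sum_comm]
    refine Finset.sum_eq_zero fun e he => ?_
    simp only [mul_assoc, ← Finset.mul_sum]
    induction e using Sym2.ind with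
    | _ p q =>
      rw [sum_rinc_mul x p q h hx, mul_zero]
      by_cases hpq : p = q
      · rw [hpq]
      · have hadj : T.Adj p q := by rw [hT, SimpleGraph.fromEdgeSet_adj]; exact ⟨he, hpq⟩
        have : T.Reachable x p ↔ T.Reachable x q :=
          ⟨fun h => h.trans hadj.reachable, fun h => h.trans hadj.symm.reachable⟩
        simp only [hh, this]

lemma exists_sum_inc_eq_of_connected (x : V) (S : Finset (Sym2 V))
    (hS : (SimpleGraph.fromEdgeSet (S : Set (Sym2 V))).Connected) (v : V) :
    ∃ z : Sym2 V → ℤ, ∀ i, i ≠ x → ∑ e ∈ S, inc e i * z e = if i = v then 1 else 0 := by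
  obtain ⟨p⟩ := hS.preconnected v x
  induction p with
  | nil => exact ⟨0, fun i hi => by simp [hi]⟩
  | @cons u w t hadj _ ih =>
    obtain ⟨z, hz⟩ := ih
    obtain ⟨ε, hε, hi⟩ := exists_sign_inc u w
    have hmem : s(u, w) ∈ S := by
      rw [SimpleGraph.fromEdgeSet_adj] at hadj; exact hadj.1
    refine ⟨fun e => z e + if e = s(u, w) then ε else 0, fun i hix => ?_⟩
    simp only [mul_add, Finset.sum_add_distrib, hz i hix, mul_ite, mul_zero,
      Finset.sum_ite_eq', hmem, if_true, hi]
    linear_combination ((if i = u then 1 else 0) - (if i = w then 1 else 0) : ℤ) * hε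

lemma det_sum_rinc_of_connected (x : V) (S : Finset (Sym2 V))
    (hS : (SimpleGraph.fromEdgeSet (S : Set (Sym2 V))).Connected)
    (hcard : S.card = Fintype.card {v : V // v ≠ x}) :
    (∑ e ∈ S, Matrix.vecMulVec (rinc x e) (rinc x e)).det = 1 := by
  choose z hz using exists_sum_inc_eq_of_connected x S hS
  have eqv : {v : V // v ≠ x} ≃ S := Fintype.equivOfCardEq (by simp [hcard])
  let N : Matrix {v : V // v ≠ x} {v : V // v ≠ x} ℤ := fun i k => rinc x (eqv k) i
  let M : Matrix {v : V // v ≠ x} {v : V // v ≠ x} ℤ := fun k j => z j (eqv k)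
  have hNM : N * M = 1 := by
    ext i j
    rw [Matrix.mul_apply, Matrix.one_apply]
    have h := hz j i i.2
    rw [← Finset.sum_coe_sort, ← eqv.sum_comp] at h
    simp only [N, M, h, Subtype.ext_iff]
  have hNN : (∑ e ∈ S, Matrix.vecMulVec (rinc x e) (rinc x e)) = N * N.transpose := by
    ext i j
    rw [Matrix.mul_apply, Matrix.sum_apply, ← Finset.sum_coe_sort, ← eqv.sum_comp]
    rfl
  have hu : IsUnit N.det := by
    have := congrArg Matrix.det hNM
    rw [Matrix.det_mul, Matrix.det_one] at this
    exact IsUnit.of_mul_eq_one _ this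
  rw [hNN, Matrix.det_mul, Matrix.det_transpose]
  rcases Int.isUnit_iff.1 hu with h | h <;> rw [h] <;> norm_num

/-- The Laplacian of the weighted graph with the row and column of `x` removed. -/
def rlap (G : SimpleGraph V) [DecidableRel G.Adj] (w : Sym2 V → ℝ) (x : V) :
    Matrix {v : V // v ≠ x} {v : V // v ≠ x} ℝ :=
  fun i j => (if i = j then vw G w i else 0) - if G.Adj i j then w s(i, j) else 0

lemma sum_edge_inc_mul_inc (G : SimpleGraph V) [DecidableRel G.Adj] (w : Sym2 V → ℝ) (i j : V) :
    ∑ e ∈ G.edgeFinset, w e * ((inc e i * inc e j : ℤ) : ℝ) =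
      (if i = j then vw G w i else 0) - if G.Adj i j then w s(i, j) else 0 := by
  by_cases hij : i = j
  · subst hij
    simp only [if_true, SimpleGraph.irrefl, if_false, sub_zero, vw]
    rw [← Finset.sum_image (s := G.neighborFinset i) (g := fun j => s(i, j)) (f := w)
      (fun _ _ _ _ h => Sym2.congr_right.1 h)]
    refine (Finset.sum_subset_zero_on_sdiff ?_ ?_ ?_).symm
    · intro e he
      obtain ⟨j, hj, rfl⟩ := Finset.mem_image.1 he
      simpa using hj
    · intro e he
      rw [Finset.mem_sdiff] at he
      obtain ⟨he, hn⟩ := he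
      induction e using Sym2.ind with
      | _ p q =>
        rw [inc_mul_inc]
        have hadj : G.Adj p q := by simpa using he
        have h1 : i ≠ p := by
          rintro rfl; exact hn (Finset.mem_image.2 ⟨q, by simpa using hadj, rfl⟩)
        have h2 : i ≠ q := by
          rintro rfl; exact hn (Finset.mem_image.2 ⟨p, by simpa using hadj.symm, Sym2.eq_swap⟩)
        simp [h1, h2]
    · intro e he
      obtain ⟨j, hj, rfl⟩ := Finset.mem_image.1 he
      have hne : i ≠ j := by
        rintro rfl; simp at hj
      rw [inc_mul_inc]
      simp [hne]
  · simp only [hij, if_false, zero_sub]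
    have h0 : ∀ e ∈ G.edgeFinset, e ≠ s(i, j) → w e * ((inc e i * inc e j : ℤ) : ℝ) = 0 := by
      intro e he hne
      induction e using Sym2.ind with
      | _ p q =>
        rw [inc_mul_inc]
        by_cases h1 : i = p <;> by_cases h2 : i = q <;> by_cases h3 : j = p <;>
          by_cases h4 : j = q <;> simp_all [Sym2.eq_swap]
    by_cases hadj : G.Adj i j
    · rw [Finset.sum_eq_single s(i, j) h0 (fun h => absurd (by simpa using hadj) h), inc_mul_inc]
      simp [hij, Ne.symm hij, hadj]
    · rw [if_neg hadj, neg_zero]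
      refine Finset.sum_eq_zero fun e he => h0 e he ?_
      rintro rfl
      exact hadj (by simpa using he)

/-- The matrix-tree theorem. -/
lemma tau_eq_det_rlap (G : SimpleGraph V) [DecidableRel G.Adj] (w : Sym2 V → ℝ) (x : V) :
    tau G w = (rlap G w x).det := by
  have hM : rlap G w x = ∑ e, (if e ∈ G.edgeFinset then w e else 0) •
      Matrix.vecMulVec (fun v => (rinc x e v : ℝ)) (fun v => (rinc x e v : ℝ)) := by
    ext i j
    simp only [rlap, Subtype.ext_iff]
    rw [← sum_edge_inc_mul_inc]
    simp only [Matrix.sum_apply, Matrix.smul_apply, Matrix.vecMulVec_apply, smul_eq_mul, ite_mul,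
      zero_mul, Finset.sum_ite_mem, Finset.univ_inter, Int.cast_mul]
  rw [hM, det_sum_smul_vecMulVec, tau]
  have hcast : ∀ S : Finset (Sym2 V),
      (∑ e ∈ S, Matrix.vecMulVec (fun v => (rinc x e v : ℝ)) (fun v => (rinc x e v : ℝ))).det =
      (((∑ e ∈ S, Matrix.vecMulVec (rinc x e) (rinc x e)).det : ℤ) : ℝ) := by
    intro S
    refine Eq.trans ?_ ((Int.castRingHom ℝ).map_det _).symm
    congr 1
    ext i j
    simp [Matrix.sum_apply, Matrix.vecMulVec_apply]
  have hcV : Fintype.card {v : V // v ≠ x} + 1 = Fintype.card V := by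
    have : 0 < Fintype.card V := Fintype.card_pos_iff.2 ⟨x⟩
    simp only [ne_eq, Fintype.card_subtype_compl, Fintype.card_subtype_eq]
    omega
  have hedge : ∀ S ⊆ G.edgeFinset,
      (SimpleGraph.fromEdgeSet (S : Set (Sym2 V))).edgeSet = (S : Set (Sym2 V)) := by
    intro S hS
    rw [SimpleGraph.edgeSet_fromEdgeSet, sdiff_eq_left, Set.disjoint_left]
    intro e he hd
    exact G.not_isDiag_of_mem_edgeFinset (hS he) hd
  have htree : ∀ S ⊆ G.edgeFinset, ((SimpleGraph.fromEdgeSet (S : Set (Sym2 V))).IsTree ↔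
      (SimpleGraph.fromEdgeSet (S : Set (Sym2 V))).Connected ∧
        S.card = Fintype.card {v : V // v ≠ x}) := by
    intro S hS
    rw [SimpleGraph.isTree_iff_connected_and_card, hedge S hS, Nat.card_eq_fintype_card (α := V),
      ← hcV]
    simp
  have hsub : spanningTrees G ⊆
      Finset.powersetCard (Fintype.card {v : V // v ≠ x}) Finset.univ := by
    intro S hS
    obtain ⟨h1, h2⟩ := Finset.mem_filter.1 hS
    exact Finset.mem_powersetCard.2
      ⟨Finset.subset_univ _, ((htree S (Finset.mem_powerset.1 h1)).1 h2).2⟩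
  rw [← Finset.sum_subset hsub]
  · refine Finset.sum_congr rfl fun S hS => ?_
    obtain ⟨h1, h2⟩ := Finset.mem_filter.1 hS
    have h3 := (htree S (Finset.mem_powerset.1 h1)).1 h2
    rw [hcast, det_sum_rinc_of_connected x S h3.1 h3.2, Int.cast_one, mul_one]
    exact Finset.prod_congr rfl fun e he => by
      rw [if_pos (Finset.mem_powerset.1 h1 he)]
  · intro S hS hST
    by_cases hSE : S ⊆ G.edgeFinset
    · rw [hcast, det_sum_rinc_of_not_connected, Int.cast_zero, mul_zero]
      intro hc
      exact hST (Finset.mem_filter.2 ⟨Finset.mem_powerset.2 hSE,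
        (htree S hSE).2 ⟨hc, (Finset.mem_powersetCard.1 hS).2⟩⟩)
    · obtain ⟨e, he, he'⟩ := Finset.not_subset.1 hSE
      rw [Finset.prod_eq_zero he (by rw [if_neg he']), zero_mul]

/-- The block of `A` indexed by `S`, completed by the identity outside `S`. -/
def pad (S : Finset V) (A : V → V → ℝ) : Matrix V V ℝ :=
  fun i j => if i ∈ S ∧ j ∈ S then A i j else if i = j then 1 else 0

/-- Schur complement with respect to a single pivot. -/
lemma det_pad_insert (S : Finset V) (n : V) (hn : n ∉ S) (A : V → V → ℝ) (hp : A n n ≠ 0) :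
    (pad (insert n S) A).det =
      A n n * (pad S (fun i j => A i j - A i n * A n j / A n n)).det := by
  set M' := pad S (fun i j => A i j - A i n * A n j / A n n) with hM'
  set r : V → ℝ := fun j => pad (insert n S) A n j with hr
  have h1 : (pad (insert n S) A).det = (M' * (1 : Matrix V V ℝ).updateRow n r).det := by
    refine Matrix.det_eq_of_forall_row_eq_smul_add_const
      (fun i => if i ∈ S then A i n / A n n else 0) n (by simp [hn]) fun i j => ?_
    have hcol : ∀ i, M' i n = if i = n then 1 else 0 := by
      intro i
      simp [hM', pad, hn]
    have hmul : ∀ i j, (M' * (1 : Matrix V V ℝ).updateRow n r) i j =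
        (if i = n then r j else 0) + if j = n then 0 else M' i j := by
      intro i j
      rw [Matrix.mul_apply, ← Finset.add_sum_erase _ _ (Finset.mem_univ n), hcol i,
        Matrix.updateRow_self]
      congr 1
      · split_ifs <;> simp
      · rw [Finset.sum_congr rfl (g := fun k => if k = j then M' i k else 0)]
        · rw [Finset.sum_ite_eq']
          by_cases hj : j = n <;> simp [hj]
        · intro k hk
          rw [Matrix.updateRow_ne (Finset.ne_of_mem_erase hk), Matrix.one_apply]
          split_ifs <;> simp
    rw [hmul, hmul, if_pos rfl]
    by_cases hi : i = n
    · subst hi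
      by_cases hj : j = i
      · simp [hr, hn, hj]
      · simp [hr, hn, hj, hM', pad, Ne.symm hj]
    · by_cases hj : j = n
      · subst hj
        by_cases hiS : i ∈ S <;> simp [hr, hi, hiS, pad, hp]
      · by_cases hiS : i ∈ S <;> by_cases hjS : j ∈ S <;>
          simp [hr, hi, hj, Ne.symm hj, hn, hiS, hjS, hM', pad]
        ring
  have h2 : ((1 : Matrix V V ℝ).updateRow n r).det = A n n := by
    have h := Matrix.cramer_transpose_apply (1 : Matrix V V ℝ) r n
    rw [← h, Matrix.transpose_one, Matrix.cramer_one]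
    simp [hr, pad]
  rw [h1, Matrix.det_mul, h2, mul_comm]

/-- The random Schrödinger matrix `2β - W` associated with the field `u`. -/
def schroed (W : V → V → ℝ) (R : Finset V) (u : V → ℝ) (i j : V) : ℝ :=
  (if i = j then ∑ k ∈ R, W i k * exp (u k - u i) else 0) - W i j

/-- The interaction energy of the field `u`. -/
def energy (W : V → V → ℝ) (R : Finset V) (u : V → ℝ) : ℝ :=
  ∑ i ∈ R, ∑ j ∈ R, W i j * (exp (u i - u j) - 1)

/-- The unnormalized density of the VRJP mixing field rooted at `x`. -/
def vrjp (W : V → V → ℝ) (x : V) (S : Finset V) (u : V → ℝ) : ℝ :=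
  √((pad S (schroed W (insert x S) u)).det) * exp (-(energy W (insert x S) u) / 2)

/-- Conductances after elimination of the vertex `n`. -/
def elim (W : V → V → ℝ) (n : V) (c : ℝ) (i j : V) : ℝ := W i j + W i n * W n j / c

lemma pad_congr (S : Finset V) (A B : V → V → ℝ) (h : ∀ i ∈ S, ∀ j ∈ S, A i j = B i j) :
    pad S A = pad S B := by
  ext i j
  simp only [pad]
  split_ifs with hij
  · exact h i hij.1 j hij.2
  · rfl
  · rfl

lemma schroed_elim (W : V → V → ℝ) (n : V) (R : Finset V) (hn : n ∉ R)
    (u : V → ℝ) (c : ℝ) (hc : 0 < c)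
    (hu : exp (u n) * c = ∑ k ∈ R, W n k * exp (u k)) :
    schroed W (insert n R) u n n = c ∧ ∀ i ∈ R, ∀ j ∈ R,
      schroed W (insert n R) u i j - schroed W (insert n R) u i n * schroed W (insert n R) u n j /
        schroed W (insert n R) u n n = schroed (elim W n c) R u i j := by
  have h1 : schroed W (insert n R) u n n = c := by
    rw [schroed, if_pos rfl, Finset.sum_insert hn, sub_self, exp_zero]
    have : ∑ k ∈ R, W n k * exp (u k - u n) = c := by
      have h : ∀ k, W n k * exp (u k - u n) = W n k * exp (u k) * (exp (u n))⁻¹ := by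
        intro k; rw [exp_sub]; ring
      simp only [h, ← Finset.sum_mul, ← hu]
      field_simp
    rw [this]; ring
  refine ⟨h1, fun i hi j hj => ?_⟩
  have hin : i ≠ n := fun h => hn (h ▸ hi)
  have hjn : j ≠ n := fun h => hn (h ▸ hj)
  rw [h1]
  simp only [schroed, hin, Ne.symm hjn, if_false, zero_sub, elim]
  by_cases hij : i = j
  · subst hij
    simp only [if_true, add_mul, Finset.sum_add_distrib, Finset.sum_insert hn]
    have : ∑ k ∈ R, W i n * W n k / c * exp (u k - u i) = W i n * exp (u n - u i) := by
      have h : ∀ k, W i n * W n k / c * exp (u k - u i) =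
          W n k * exp (u k) * (W i n / c * (exp (u i))⁻¹) := by
        intro k; rw [exp_sub]; field_simp
      simp only [h, ← Finset.sum_mul, ← hu]
      rw [exp_sub]
      field_simp
    rw [this]
    ring
  · simp only [hij, if_false]
    ring

lemma energy_elim (W : V → V → ℝ) (hW : ∀ i j, W i j = W j i) (n : V) (R : Finset V)
    (hn : n ∉ R) (u : V → ℝ) (c : ℝ) (hc : 0 < c)
    (hu : exp (u n) * c = ∑ k ∈ R, W n k * exp (u k)) :
    energy W (insert n R) u = energy (elim W n c) R u +
      (c + (∑ k ∈ R, W n k) ^ 2 / c - 2 * ∑ k ∈ R, W n k) := by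
  have hA : ∑ k ∈ R, W n k * exp (u k - u n) = c := by
    have h : ∀ k, W n k * exp (u k - u n) = W n k * exp (u k) * (exp (u n))⁻¹ := by
      intro k; rw [exp_sub]; ring
    simp only [h, ← Finset.sum_mul, ← hu]
    field_simp
  have hB : ∑ i ∈ R, ∑ j ∈ R, W i n * W n j / c * exp (u i - u j) =
      ∑ k ∈ R, W n k * exp (u n - u k) := by
    rw [Finset.sum_comm]
    refine Finset.sum_congr rfl fun j _ => ?_
    have h : ∀ i, W i n * W n j / c * exp (u i - u j) =
        W n i * exp (u i) * (W n j / c * (exp (u j))⁻¹) := by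
      intro i; rw [exp_sub, hW i n]; field_simp
    simp only [h, ← Finset.sum_mul, ← hu]
    rw [exp_sub]
    field_simp
  have hC : ∑ i ∈ R, ∑ j ∈ R, W i n * W n j / c = (∑ k ∈ R, W n k) ^ 2 / c := by
    rw [sq, Finset.sum_mul_sum, Finset.sum_div]
    refine Finset.sum_congr rfl fun i _ => ?_
    rw [Finset.sum_div]
    exact Finset.sum_congr rfl fun j _ => by rw [hW i n]
  have hD : ∑ i ∈ R, W i n * exp (u i - u n) = c := by
    rw [← hA]; exact Finset.sum_congr rfl fun i _ => by rw [hW i n]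
  have hE : ∑ i ∈ R, W i n = ∑ i ∈ R, W n i := Finset.sum_congr rfl fun i _ => hW i n
  simp only [energy, elim, Finset.sum_insert hn, sub_self, exp_zero, zero_add,
    Finset.sum_add_distrib, add_mul, mul_sub, mul_one, Finset.sum_sub_distrib, hB, hC, hD, hE]
  ring

lemma vrjp_elim (W : V → V → ℝ) (hW : ∀ i j, W i j = W j i) (x n : V) (S : Finset V)
    (hn : n ∉ insert x S) (u : V → ℝ) (v : ℝ)
    (hpos : 0 < ∑ k ∈ insert x S, W n k * exp (u k)) :
    vrjp W x (insert n S)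
        (Function.update u n (log (∑ k ∈ insert x S, W n k * exp (u k)) - v)) =
      vrjp (elim W n (exp v)) x S u * (exp (v / 2) * exp (-(exp v +
        (∑ k ∈ insert x S, W n k) ^ 2 * exp (-v) - 2 * ∑ k ∈ insert x S, W n k) / 2)) := by
  set u' := Function.update u n (log (∑ k ∈ insert x S, W n k * exp (u k)) - v) with hu'
  have huR : ∀ k ∈ insert x S, u' k = u k := by
    intro k hk
    rw [hu', Function.update_of_ne]
    rintro rfl; exact hn hk
  have hu : exp (u' n) * exp v = ∑ k ∈ insert x S, W n k * exp (u' k) := by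
    rw [Finset.sum_congr rfl fun k hk => by rw [huR k hk], hu', Function.update_self, exp_sub,
      exp_log hpos]
    field_simp
  obtain ⟨h1, h2⟩ := schroed_elim W n (insert x S) hn u' (exp v) (exp_pos v) hu
  have h3 := energy_elim W hW n (insert x S) hn u' (exp v) (exp_pos v) hu
  have hE : energy (elim W n (exp v)) (insert x S) u' =
      energy (elim W n (exp v)) (insert x S) u := by
    refine Finset.sum_congr rfl fun i hi => Finset.sum_congr rfl fun j hj => ?_
    rw [huR i hi, huR j hj]
  have hH : ∀ i ∈ insert x S, ∀ j, schroed (elim W n (exp v)) (insert x S) u' i j =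
      schroed (elim W n (exp v)) (insert x S) u i j := by
    intro i hi j
    rw [schroed, schroed, huR i hi]
    rw [Finset.sum_congr rfl fun k hk => by rw [huR k hk]]
  have hnS : n ∉ S := fun h => hn (Finset.mem_insert_of_mem h)
  rw [vrjp, Finset.insert_comm x n S, det_pad_insert S n hnS _ (by rw [h1]; exact (exp_pos v).ne'),
    pad_congr S _ (schroed (elim W n (exp v)) (insert x S) u), h1, h3, hE, vrjp,
    Real.sqrt_mul (exp_pos v).le, ← exp_half]
  · have : -(energy (elim W n (exp v)) (insert x S) u + (exp v +
        (∑ k ∈ insert x S, W n k) ^ 2 / exp v - 2 * ∑ k ∈ insert x S, W n k)) / 2 =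
        -(energy (elim W n (exp v)) (insert x S) u) / 2 + -(exp v +
        (∑ k ∈ insert x S, W n k) ^ 2 * exp (-v) - 2 * ∑ k ∈ insert x S, W n k) / 2 := by
      rw [exp_neg]; ring
    rw [this, exp_add]
    ring
  · intro i hi j hj
    rw [h2 i (Finset.mem_insert_of_mem hi) j (Finset.mem_insert_of_mem hj),
      hH i (Finset.mem_insert_of_mem hi)]

lemma continuous_vrjp {α : Type*} [TopologicalSpace α] (W : α → V → V → ℝ) (u : α → V → ℝ)
    (hW : ∀ i j, Continuous fun a => W a i j) (hu : ∀ i, Continuous fun a => u a i)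
    (x : V) (S : Finset V) : Continuous fun a => vrjp (W a) x S (u a) := by
  have hS : ∀ i j, Continuous fun a => schroed (W a) (insert x S) (u a) i j := by
    intro i j
    by_cases h : i = j
    · simp only [schroed, h, if_true]; fun_prop
    · simp only [schroed, h, if_false]; fun_prop
  have hM : Continuous fun a => pad S (schroed (W a) (insert x S) (u a)) := by
    refine continuous_matrix fun i j => ?_
    by_cases h : i ∈ S ∧ j ∈ S
    · simpa only [pad, h, and_self, if_true] using hS i j
    · simp only [pad, h, if_false]; exact continuous_const
  have hE : Continuous fun a => energy (W a) (insert x S) (u a) := by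
    unfold energy; fun_prop
  have := hM.matrix_det
  unfold vrjp
  fun_prop

lemma lintegral_exp_mul_exp_neg_exp {b r κ : ℝ} (hb : 0 < b) (hr : 0 < r) (hκ : κ ≠ 0) :
    ∫⁻ t : ℝ, ENNReal.ofReal (exp (b * (κ * t)) * exp (-(r * exp (κ * t)))) =
      ENNReal.ofReal (Gamma b * r ^ (-b) / |κ|) := by
  have himg : (fun t : ℝ => exp (κ * t)) '' Set.univ = Set.Ioi 0 := by
    ext y
    simp only [Set.image_univ, Set.mem_range, Set.mem_Ioi]
    refine ⟨fun ⟨t, ht⟩ => ht ▸ exp_pos _, fun hy => ⟨log y / κ, ?_⟩⟩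
    rw [mul_div_cancel₀ _ hκ, exp_log hy]
  have h := lintegral_image_eq_lintegral_abs_deriv_mul (s := Set.univ)
    (f := fun t : ℝ => exp (κ * t)) (f' := fun t => exp (κ * t) * (κ * 1)) MeasurableSet.univ
    (fun t _ => (((hasDerivAt_id t).const_mul κ).exp).hasDerivWithinAt)
    (fun s _ t _ hst => mul_left_cancel₀ hκ (exp_injective hst))
    (fun y => ENNReal.ofReal (|κ|⁻¹ * (y ^ (b - 1) * exp (-(r * y)))))
  rw [himg, setLIntegral_univ] at h
  have h1 : ∀ t : ℝ, ENNReal.ofReal |exp (κ * t) * (κ * 1)| * ENNReal.ofReal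
      (|κ|⁻¹ * (exp (κ * t) ^ (b - 1) * exp (-(r * exp (κ * t))))) =
      ENNReal.ofReal (exp (b * (κ * t)) * exp (-(r * exp (κ * t)))) := by
    intro t
    rw [← ENNReal.ofReal_mul (abs_nonneg _), mul_one, abs_mul, abs_of_pos (exp_pos _),
      ← exp_mul]
    congr 1
    have : exp (b * (κ * t)) = exp (κ * t) * exp (κ * t * (b - 1)) := by
      rw [← exp_add]; ring_nf
    rw [this]
    have := abs_pos.2 hκ
    field_simp
  simp only [h1] at h
  have hint := Real.integral_rpow_mul_exp_neg_mul_Ioi hb hr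
  have hpos : 0 < (1 / r) ^ b * Gamma b := mul_pos (rpow_pos_of_pos (by positivity) _)
    (Gamma_pos_of_pos hb)
  have hI : IntegrableOn (fun t : ℝ => t ^ (b - 1) * exp (-(r * t))) (Set.Ioi 0) := by
    by_contra hc
    rw [integral_undef hc] at hint
    exact hpos.ne hint
  rw [← h, ← ofReal_integral_eq_lintegral_ofReal (hI.const_mul _), integral_const_mul, hint]
  · congr 1
    rw [one_div, inv_rpow hr.le, rpow_neg hr.le]
    ring
  · refine (ae_restrict_iff' measurableSet_Ioi).2 (ae_of_all _ fun y hy => ?_)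
    have := rpow_nonneg (le_of_lt hy) (b - 1)
    simp only [Pi.zero_apply]
    positivity

lemma lintegral_inverse_gaussian {s : ℝ} (hs : 0 < s) :
    ∫⁻ v : ℝ, ENNReal.ofReal (exp (v / 2) * exp (-(exp v + s ^ 2 * exp (-v) - 2 * s) / 2)) =
      ENNReal.ofReal √(2 * π) := by
  set f : ℝ → ℝ := fun v => exp (v / 2) - s * exp (-v / 2) with hf
  have hsq : ∀ v, exp v + s ^ 2 * exp (-v) - 2 * s = f v ^ 2 := by
    intro v
    have h1 : exp v = exp (v / 2) * exp (v / 2) := by rw [← exp_add]; ring_nf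
    have h2 : exp (-v) = exp (-v / 2) * exp (-v / 2) := by rw [← exp_add]; ring_nf
    have h3 : exp (v / 2) * exp (-v / 2) = 1 := by rw [← exp_add]; ring_nf; exact exp_zero
    rw [h1, h2, hf]
    simp only
    linear_combination (2 * s) * h3
  simp only [hsq]
  have hmeas : Measurable fun y : ℝ => ENNReal.ofReal (exp (-y ^ 2 / 2)) := by fun_prop
  have hderiv : ∀ v, HasDerivAt f (exp (v / 2) * (1 / 2) - s * (exp (-v / 2) * (-1 / 2))) v := by
    intro v
    exact (((hasDerivAt_id v).div_const 2).exp).sub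
      ((((hasDerivAt_id v).neg.div_const 2).exp).const_mul s)
  have hmono : StrictMono f := by
    intro a b hab
    have h1 : exp (a / 2) < exp (b / 2) := exp_lt_exp.2 (by linarith)
    have h2 : s * exp (-b / 2) < s * exp (-a / 2) :=
      mul_lt_mul_of_pos_left (exp_lt_exp.2 (by linarith)) hs
    simp only [hf]
    linarith
  have hsurj : f '' Set.univ = Set.univ := by
    rw [Set.image_univ, Set.range_eq_univ]
    intro y
    have hlt : |y| < √(y ^ 2 + 4 * s) := by
      rw [← sqrt_sq_eq_abs]
      exact sqrt_lt_sqrt (sq_nonneg _) (by linarith)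
    have hz : 0 < (y + √(y ^ 2 + 4 * s)) / 2 := by
      have := neg_abs_le y; linarith
    set z := (y + √(y ^ 2 + 4 * s)) / 2 with hzdef
    have hz2 : z * z = y * z + s := by
      have := mul_self_sqrt (show 0 ≤ y ^ 2 + 4 * s by positivity)
      rw [hzdef]
      linear_combination this / 4
    refine ⟨2 * log z, ?_⟩
    simp only [hf]
    rw [show 2 * log z / 2 = log z by ring, show -(2 * log z) / 2 = -log z by ring, exp_neg,
      exp_log hz]
    field_simp
    linear_combination hz2
  have h := lintegral_image_eq_lintegral_abs_deriv_mul (s := Set.univ) (f := f) MeasurableSet.univ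
    (fun v _ => (hderiv v).hasDerivWithinAt) hmono.injective.injOn
    (fun y => ENNReal.ofReal (exp (-y ^ 2 / 2)))
  rw [hsurj, setLIntegral_univ, setLIntegral_univ] at h
  have hgauss : ∫⁻ y : ℝ, ENNReal.ofReal (exp (-y ^ 2 / 2)) = ENNReal.ofReal √(2 * π) := by
    have e : ∀ y : ℝ, exp (-y ^ 2 / 2) = exp (-(1 / 2) * y ^ 2) := by intro y; ring_nf
    simp only [e]
    rw [← ofReal_integral_eq_lintegral_ofReal (integrable_exp_neg_mul_sq (by norm_num))
      (ae_of_all _ fun _ => (exp_pos _).le), integral_gaussian]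
    ring_nf
  have hrefl : ∫⁻ v : ℝ, ENNReal.ofReal (exp (v / 2) * exp (-f v ^ 2 / 2)) =
      ∫⁻ v : ℝ, ENNReal.ofReal (s * exp (-v / 2) * exp (-f v ^ 2 / 2)) := by
    rw [← lintegral_sub_left_eq_self _ (2 * log s)]
    refine lintegral_congr fun v => ?_
    have h1 : exp ((2 * log s - v) / 2) = s * exp (-v / 2) := by
      rw [show (2 * log s - v) / 2 = log s + -v / 2 by ring, exp_add, exp_log hs]
    have h2 : s * exp (-(2 * log s - v) / 2) = exp (v / 2) := by
      rw [show -(2 * log s - v) / 2 = v / 2 - log s by ring, exp_sub, exp_log hs]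
      field_simp
    have h3 : f (2 * log s - v) = -f v := by
      simp only [hf, h1, h2]; ring
    rw [h1, h3, neg_sq]
  have hsum : (∫⁻ v : ℝ, ENNReal.ofReal (exp (v / 2) * exp (-f v ^ 2 / 2))) +
      (∫⁻ v : ℝ, ENNReal.ofReal (exp (v / 2) * exp (-f v ^ 2 / 2))) =
      ENNReal.ofReal √(2 * π) + ENNReal.ofReal √(2 * π) := by
    nth_rewrite 2 [hrefl]
    have hfm : Continuous f := by rw [hf]; fun_prop
    rw [← lintegral_add_left (by fun_prop), ← hgauss, ← two_mul, h,
      ← lintegral_const_mul _ (by fun_prop)]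
    refine lintegral_congr fun v => ?_
    rw [← ENNReal.ofReal_add (by positivity) (by positivity), abs_of_nonneg (by
      have := exp_pos (v / 2); have := mul_pos hs (exp_pos (-v / 2)); linarith),
      ← ENNReal.ofReal_mul (by
        have := exp_pos (v / 2); have := mul_pos hs (exp_pos (-v / 2)); linarith),
      ← ENNReal.ofReal_ofNat 2, ← ENNReal.ofReal_mul (by norm_num)]
    congr 1
    ring
  rw [← two_mul, ← two_mul] at hsum
  exact (ENNReal.mul_right_inj (by norm_num) (by norm_num)).1 hsum

section Marginal

variable {ι : Type*} [DecidableEq ι]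

lemma lmarginal_comp_add (s : Finset ι) (f : (ι → ℝ) → ℝ≥0∞) (d x : ι → ℝ) :
    lmarginal (fun _ => volume) s (fun y => f (y + d)) x =
      lmarginal (fun _ => volume) s f (x + d) := by
  simp only [lmarginal]
  change ∫⁻ y : s → ℝ, _ = ∫⁻ y : s → ℝ, _
  symm
  rw [← lintegral_add_right_eq_self _ (fun i : s => d i)]
  refine lintegral_congr fun y => ?_
  congr 1
  ext i
  by_cases h : i ∈ s <;> simp [Function.updateFinset, h]

lemma lmarginal_const_mul (s : Finset ι) (c : ℝ≥0∞) (f : (ι → ℝ) → ℝ≥0∞) (hf : Measurable f)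
    (x : ι → ℝ) :
    lmarginal (fun _ => volume) s (fun y => c * f y) x =
      c * lmarginal (fun _ => volume) s f x :=
  lintegral_const_mul _ (hf.comp measurable_updateFinset)

lemma lmarginal_prod (s : Finset ι) (f : ι → ℝ → ℝ≥0∞) (hf : ∀ i, Measurable (f i)) (x : ι → ℝ) :
    lmarginal (fun _ => volume) s (fun y => ∏ i ∈ s, f i (y i)) x = ∏ i ∈ s, ∫⁻ t, f i t := by
  induction s using Finset.induction_on generalizing x with
  | empty => simp
  | insert i s hi ih =>
    have hm : ∀ s : Finset ι, Measurable fun y : ι → ℝ => ∏ i ∈ s, f i (y i) := fun s =>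
      Finset.measurable_fun_prod s fun j _ => (hf j).comp (measurable_pi_apply j)
    rw [lmarginal_insert' _ (hm _) hi, Finset.prod_insert hi, ← ih x,
      ← lmarginal_const_mul s _ _ (hm s)]
    congr 1
    ext y
    rw [← lintegral_mul_const _ (hf i)]
    refine lintegral_congr fun t => ?_
    rw [Finset.prod_insert hi, Function.update_self]
    congr 1
    refine Finset.prod_congr rfl fun j hj => ?_
    rw [Function.update_of_ne]
    rintro rfl
    exact hi hj

lemma lintegral_lmarginal_swap {α : Type*} [MeasurableSpace α] [Fintype ι] (ν : Measure α)
    [SFinite ν] (s : Finset ι) (f : α → (ι → ℝ) → ℝ≥0∞)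
    (hf : Measurable (Function.uncurry f)) (x : ι → ℝ) :
    ∫⁻ a, lmarginal (fun _ => volume) s (f a) x ∂ν =
      lmarginal (fun _ => volume) s (fun y => ∫⁻ a, f a y ∂ν) x := by
  simp only [lmarginal]
  refine lintegral_lintegral_swap (Measurable.aemeasurable ?_)
  exact hf.comp (measurable_fst.prodMk (measurable_updateFinset.comp measurable_snd))

lemma lmarginal_swap {κ : Type*} [DecidableEq κ] [Fintype ι] [Fintype κ] (s : Finset ι)
    (t : Finset κ) (f : (κ → ℝ) → (ι → ℝ) → ℝ≥0∞)
    (hf : Measurable (Function.uncurry f)) (x : ι → ℝ) (z : κ → ℝ) :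
    lmarginal (fun _ => volume) t (fun u => lmarginal (fun _ => volume) s (f u) x) z =
      lmarginal (fun _ => volume) s (fun y => lmarginal (fun _ => volume) t (fun u => f u y) z) x :=
  lintegral_lmarginal_swap _ s (fun a : t → ℝ => f (Function.updateFinset z t a))
    (hf.comp ((measurable_updateFinset.comp measurable_fst).prodMk measurable_snd)) x

end Marginal

lemma vrjp_nonneg (W : V → V → ℝ) (x : V) (S : Finset V) (u : V → ℝ) : 0 ≤ vrjp W x S u := by
  unfold vrjp; positivity

lemma exists_elim_pos (x n : V) (S : Finset V) (W : V → V → ℝ) (h0 : ∀ i j, 0 ≤ W i j)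
    (hconn : ∀ T ⊆ insert n S, T.Nonempty →
      ∃ i ∈ T, ∃ j ∈ insert x (insert n S), j ∉ T ∧ 0 < W i j) {c : ℝ} (hc : 0 < c)
    (T : Finset V) (hT : T ⊆ S) (hTne : T.Nonempty) :
    ∃ i ∈ T, ∃ j ∈ insert x S, j ∉ T ∧ 0 < elim W n c i j := by
  have hv : ∀ k l, 0 ≤ W k n * W n l / c := fun k l =>
    div_nonneg (mul_nonneg (h0 k n) (h0 n l)) hc.le
  by_cases hdir : ∃ k ∈ T, ∃ l ∈ insert x S, l ∉ T ∧ 0 < W k l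
  · obtain ⟨k, hk, l, hl, hlT, hkl⟩ := hdir
    exact ⟨k, hk, l, hl, hlT, add_pos_of_pos_of_nonneg hkl (hv k l)⟩
  · push Not at hdir
    obtain ⟨k, hk, l, hl, hlT, hkl⟩ := hconn T (hT.trans (Finset.subset_insert _ _)) hTne
    have hln : l = n := by
      by_contra hne
      refine absurd hkl (not_lt.2 (hdir k hk l ?_ hlT))
      simp only [Finset.mem_insert] at hl ⊢
      tauto
    subst hln
    obtain ⟨k', hk', l', hl', hlT', hkl'⟩ := hconn (insert l T)
      (Finset.insert_subset_insert _ hT) (by simp)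
    simp only [Finset.mem_insert, not_or] at hlT' hl' hk'
    have hlR : l' ∈ insert x S := by
      simp only [Finset.mem_insert]; tauto
    rcases hk' with rfl | hk'
    · exact ⟨k, hk, l', hlR, hlT'.2, add_pos_of_nonneg_of_pos (h0 _ _)
        (div_pos (mul_pos hkl hkl') hc)⟩
    · exact absurd hkl' (not_lt.2 (hdir k' hk' l' hlR hlT'.2))

/-- The random field of the vertex-reinforced jump process has total mass `(2π)^{|S|/2}`. -/
theorem lmarginal_vrjp (x : V) (S : Finset V) (W : V → V → ℝ) (hx : x ∉ S)
    (hW : ∀ i j, W i j = W j i) (h0 : ∀ i j, 0 ≤ W i j)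
    (hconn : ∀ T ⊆ S, T.Nonempty → ∃ i ∈ T, ∃ j ∈ insert x S, j ∉ T ∧ 0 < W i j) (u : V → ℝ) :
    lmarginal (fun _ => volume) S (fun u => ENNReal.ofReal (vrjp W x S u)) u =
      ENNReal.ofReal √(2 * π) ^ S.card := by
  induction S using Finset.induction_on generalizing W with
  | empty =>
    have : pad ∅ (schroed W {x} u) = 1 := by
      ext i j; simp [pad, Matrix.one_apply]
    simp [vrjp, energy, this]
  | insert n S hn ih =>
    have hxn : x ≠ n := fun h => hx (h ▸ Finset.mem_insert_self _ _)
    have hxS : x ∉ S := fun h => hx (Finset.mem_insert_of_mem h)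
    have hnx : n ∉ insert x S := by simp [hn, Ne.symm hxn]
    obtain ⟨i, hi, j, hj, hjn, hij⟩ := hconn {n} (by simp) (by simp)
    rw [Finset.mem_singleton] at hi hjn
    subst hi
    have hjR : j ∈ insert x S := by
      simp only [Finset.mem_insert] at hj ⊢
      tauto
    set s := ∑ k ∈ insert x S, W i k with hs
    have hspos : 0 < s := Finset.sum_pos' (fun k _ => h0 i k) ⟨j, hjR, hij⟩
    have hSpos : ∀ u : V → ℝ, 0 < ∑ k ∈ insert x S, W i k * exp (u k) := fun u =>
      Finset.sum_pos' (fun k _ => mul_nonneg (h0 i k) (exp_pos _).le)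
        ⟨j, hjR, mul_pos hij (exp_pos _)⟩
    set g : ℝ → ℝ := fun v =>
      exp (v / 2) * exp (-(exp v + s ^ 2 * exp (-v) - 2 * s) / 2) with hg
    have hgc : Continuous g := by rw [hg]; fun_prop
    have hmeas : Measurable fun u => ENNReal.ofReal (vrjp W x (insert i S) u) :=
      (continuous_vrjp (fun _ => W) (fun u => u) (fun _ _ => continuous_const)
        (fun _ => by fun_prop) x _).measurable.ennreal_ofReal
    have helim : Measurable (Function.uncurry fun (v : ℝ) (u : V → ℝ) =>
        ENNReal.ofReal (vrjp (elim W i (exp v)) x S u)) := by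
      refine (continuous_vrjp (fun p : ℝ × (V → ℝ) => elim W i (exp p.1)) (fun p => p.2)
        (fun k l => ?_) (fun _ => by fun_prop) x _).measurable.ennreal_ofReal
      unfold elim
      exact continuous_const.add (continuous_const.div (by fun_prop) fun p => (exp_pos _).ne')
    have helim' : ∀ v : ℝ, Measurable fun u : V → ℝ =>
        ENNReal.ofReal (vrjp (elim W i (exp v)) x S u) := fun v =>
      (continuous_vrjp (fun _ => elim W i (exp v)) (fun u => u) (fun _ _ => continuous_const)
        (fun _ => by fun_prop) x _).measurable.ennreal_ofReal
    have hprod : Measurable (Function.uncurry fun (v : ℝ) (u : V → ℝ) =>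
        ENNReal.ofReal (g v) * ENNReal.ofReal (vrjp (elim W i (exp v)) x S u)) := by
      have h1 : Measurable fun p : ℝ × (V → ℝ) => ENNReal.ofReal (g p.1) :=
        hgc.measurable.ennreal_ofReal.comp measurable_fst
      exact h1.mul helim
    have hfib : ∀ u : V → ℝ,
        ∫⁻ t, ENNReal.ofReal (vrjp W x (insert i S) (Function.update u i t)) =
        ∫⁻ v, ENNReal.ofReal (g v) * ENNReal.ofReal (vrjp (elim W i (exp v)) x S u) := by
      intro u
      rw [← lintegral_sub_left_eq_self _ (log (∑ k ∈ insert x S, W i k * exp (u k)))]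
      refine lintegral_congr fun v => ?_
      rw [vrjp_elim W hW x i S hnx u v (hSpos u), ENNReal.ofReal_mul (vrjp_nonneg _ _ _ _),
        mul_comm]
    rw [lmarginal_insert' _ hmeas hn]
    simp only [hfib]
    rw [← lintegral_lmarginal_swap volume S
      (fun v u => ENNReal.ofReal (g v) * ENNReal.ofReal (vrjp (elim W i (exp v)) x S u)) hprod]
    · rw [lintegral_congr (g := fun v => ENNReal.ofReal (g v) * ENNReal.ofReal √(2 * π) ^ S.card)]
      · rw [lintegral_mul_const _ hgc.measurable.ennreal_ofReal,
          lintegral_inverse_gaussian hspos, Finset.card_insert_of_notMem hn, pow_succ, mul_comm]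
      · intro v
        rw [lmarginal_const_mul S _ _ (helim' v)]
        congr 1
        have hv : ∀ k l, 0 ≤ W k i * W i l / exp v := fun k l =>
          div_nonneg (mul_nonneg (h0 k i) (h0 i l)) (exp_pos v).le
        refine ih (elim W i (exp v)) hxS (fun k l => ?_) (fun k l => ?_) fun T hT hTne => ?_
        · simp only [elim, hW k l, hW k i, hW l i]; ring
        · exact add_nonneg (h0 k l) (hv k l)
        · exact exists_elim_pos x i S W h0 hconn (exp_pos v) T hT hTne

lemma sum_mul_ssum (G : SimpleGraph V) [DecidableRel G.Adj] (w : Sym2 V → ℝ) (g : V → ℝ) :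
    ∑ e ∈ G.edgeFinset, w e * ssum g e = ∑ v, vw G w v * g v := by
  have h : ∀ e ∈ G.edgeFinset, ssum g e = ∑ v, ((inc e v * inc e v : ℤ) : ℝ) * g v := by
    intro e he
    induction e using Sym2.ind with
    | _ p q =>
      have hpq : p ≠ q := by
        have hadj : G.Adj p q := by simpa using he
        exact hadj.ne
      have h1 : ∀ v, ((inc s(p, q) v * inc s(p, q) v : ℤ) : ℝ) * g v =
          (if v = p then g v else 0) + if v = q then g v else 0 := by
        intro v
        rw [inc_mul_inc]
        by_cases h1 : v = p <;> by_cases h2 : v = q <;> simp_all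
      simp only [h1, Finset.sum_add_distrib, Finset.sum_ite_eq', Finset.mem_univ, if_true]
      rfl
  rw [Finset.sum_congr rfl fun e he => by rw [h e he, Finset.mul_sum], Finset.sum_comm]
  refine Finset.sum_congr rfl fun v _ => ?_
  have h2 := sum_edge_inc_mul_inc G w v v
  simp only [if_true, SimpleGraph.irrefl, if_false, sub_zero] at h2
  rw [← h2, Finset.sum_mul]
  exact Finset.sum_congr rfl fun e _ => by ring

lemma sum_vw (G : SimpleGraph V) [DecidableRel G.Adj] (w : Sym2 V → ℝ) :
    ∑ v, vw G w v = 2 * ∑ e ∈ G.edgeFinset, w e := by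
  have h := sum_mul_ssum G w fun _ => 1
  simp only [mul_one] at h
  rw [← h, Finset.mul_sum]
  refine Finset.sum_congr rfl fun e _ => ?_
  have : ssum (fun _ : V => (1 : ℝ)) e = 2 := by
    induction e using Sym2.ind with
    | _ p q => exact one_add_one_eq_two
  rw [this, mul_comm]

/-- The conductance matrix of a weighted graph. -/
def adjWeight (G : SimpleGraph V) [DecidableRel G.Adj] (w : Sym2 V → ℝ) (i j : V) : ℝ :=
  if G.Adj i j then w s(i, j) else 0

lemma sum_adjWeight (G : SimpleGraph V) [DecidableRel G.Adj] (w : Sym2 V → ℝ) (i : V) :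
    ∑ j, adjWeight G w i j = vw G w i := by
  simp only [adjWeight, vw, SimpleGraph.neighborFinset_eq_filter, Finset.sum_filter]

lemma adjWeight_comm (G : SimpleGraph V) [DecidableRel G.Adj] (w : Sym2 V → ℝ) (i j : V) :
    adjWeight G w i j = adjWeight G w j i := by
  simp only [adjWeight, G.adj_comm i j, Sym2.eq_swap (a := i)]

lemma adjWeight_shift (G : SimpleGraph V) [DecidableRel G.Adj] (y : Sym2 V → ℝ) (u : V → ℝ)
    (i j : V) :
    adjWeight G (fun e => exp (y e - ssum u e)) i j =
      exp (-u i) * adjWeight G (fun e => exp (y e)) i j * exp (-u j) := by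
  unfold adjWeight
  split_ifs
  · change exp (y s(i, j) - (u i + u j)) = _
    rw [← exp_add, ← exp_add]
    congr 1
    ring
  · simp

lemma det_pad_erase (x : V) (A : V → V → ℝ) :
    (pad (Finset.univ.erase x) A).det =
      (Matrix.of fun i j : {v : V // v ≠ x} => A i j).det := by
  rw [Matrix.twoBlockTriangular_det _ (fun v => v ≠ x)]
  · have h : ((pad (Finset.univ.erase x) A).toSquareBlockProp fun i => ¬ i ≠ x) = 1 := by
      ext ⟨i, hi⟩ ⟨j, hj⟩
      simp only [ne_eq, not_not] at hi hj
      simp [Matrix.toSquareBlockProp, pad, hi, hj, Matrix.one_apply]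
    rw [h, Matrix.det_one, mul_one]
    congr 1
    ext ⟨i, hi⟩ ⟨j, hj⟩
    simp [Matrix.toSquareBlockProp, pad, hi, hj]
  · intro i hi j hj
    simp only [ne_eq, not_not] at hi
    simp [pad, hi, Ne.symm hj]

lemma vrjp_shift (G : SimpleGraph V) [DecidableRel G.Adj] (x : V) (y : Sym2 V → ℝ) (u : V → ℝ) :
    vrjp (adjWeight G fun e => exp (y e - ssum u e)) x (Finset.univ.erase x) u =
      √(tau G fun e => exp (y e)) * exp (-∑ v ∈ Finset.univ.erase x, u v) *
        exp (∑ e ∈ G.edgeFinset, exp (y e - ssum u e)) *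
        exp (-(∑ v, vw G (fun e => exp (y e)) v * exp (-2 * u v)) / 2) := by
  have huniv : insert x (Finset.univ.erase x) = Finset.univ :=
    Finset.insert_erase (Finset.mem_univ x)
  have hdet : (pad (Finset.univ.erase x) (schroed (adjWeight G fun e => exp (y e - ssum u e))
      Finset.univ u)).det =
      exp (-∑ v ∈ Finset.univ.erase x, u v) ^ 2 * tau G fun e => exp (y e) := by
    rw [det_pad_erase, tau_eq_det_rlap _ _ x]
    have hM : (Matrix.of fun i j : {v : V // v ≠ x} =>
        schroed (adjWeight G fun e => exp (y e - ssum u e)) Finset.univ u i j) =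
        Matrix.diagonal (fun i : {v : V // v ≠ x} => exp (-u i)) *
          rlap G (fun e => exp (y e)) x *
          Matrix.diagonal (fun i : {v : V // v ≠ x} => exp (-u i)) := by
      ext i j
      rw [Matrix.mul_diagonal, Matrix.diagonal_mul, Matrix.of_apply, schroed, adjWeight_shift, rlap]
      have h1 : ∑ k, adjWeight G (fun e => exp (y e - ssum u e)) i k * exp (u k - u i) =
          exp (-u i) * vw G (fun e => exp (y e)) i * exp (-u i) := by
        rw [← sum_adjWeight, Finset.mul_sum, Finset.sum_mul]
        refine Finset.sum_congr rfl fun k _ => ?_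
        rw [adjWeight_shift, sub_eq_add_neg, exp_add, exp_neg (u k)]
        field_simp
      rw [h1]
      by_cases hij : i = j
      · subst hij
        simp only [if_true, adjWeight]
        ring
      · simp only [hij, Subtype.ext_iff.not.1 hij, if_false, adjWeight]
        ring
    rw [hM, Matrix.det_mul, Matrix.det_mul, Matrix.det_diagonal, ← exp_sum,
      Finset.sum_neg_distrib, ← Finset.sum_subtype (Finset.univ.erase x) (by simp) u]
    ring
  have hen : energy (adjWeight G fun e => exp (y e - ssum u e)) Finset.univ u =
      (∑ v, vw G (fun e => exp (y e)) v * exp (-2 * u v)) -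
        2 * ∑ e ∈ G.edgeFinset, exp (y e - ssum u e) := by
    rw [← sum_vw, energy]
    simp only [mul_sub, mul_one, Finset.sum_sub_distrib, sum_adjWeight]
    congr 1
    rw [Finset.sum_comm]
    refine Finset.sum_congr rfl fun j _ => ?_
    rw [← sum_adjWeight, Finset.sum_mul]
    refine Finset.sum_congr rfl fun i _ => ?_
    rw [adjWeight_shift, adjWeight_comm, sub_eq_add_neg, exp_add, exp_neg (u i),
      show -2 * u j = -u j + -u j by ring, exp_add]
    field_simp
  rw [vrjp, huniv, hdet, hen, Real.sqrt_mul (by positivity), Real.sqrt_sq (exp_pos _).le,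
    mul_comm (exp _) (√ _), mul_assoc _ (exp (∑ e ∈ G.edgeFinset, _)), ← exp_add]
  congr 2
  ring

lemma prod_mul_vrjp_shift (G : SimpleGraph V) [DecidableRel G.Adj] (x : V) (B y : Sym2 V → ℝ)
    (u : V → ℝ) (hu : u x = 0) :
    (∏ e ∈ G.edgeFinset, (exp (B e * (y e - ssum u e)) * exp (-exp (y e - ssum u e)))) *
        vrjp (adjWeight G fun e => exp (y e - ssum u e)) x (Finset.univ.erase x) u =
      ((∏ e ∈ G.edgeFinset, exp (B e * y e)) * √(tau G fun e => exp (y e)) *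
        exp (-(1 / 2 * vw G (fun e => exp (y e)) x))) *
      ∏ v ∈ Finset.univ.erase x, (exp (bwt G x B v * (-2 * u v)) *
        exp (-(vw G (fun e => exp (y e)) v / 2 * exp (-2 * u v)))) := by
  rw [vrjp_shift]
  simp only [Finset.prod_mul_distrib, ← exp_sum]
  have h1 : ∑ e ∈ G.edgeFinset, B e * (y e - ssum u e) =
      (∑ e ∈ G.edgeFinset, B e * y e) - ∑ v ∈ Finset.univ.erase x, vw G B v * u v := by
    simp only [mul_sub, Finset.sum_sub_distrib, sum_mul_ssum]
    rw [← Finset.add_sum_erase _ _ (Finset.mem_univ x), hu, mul_zero, zero_add]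
  have h2 : ∑ v ∈ Finset.univ.erase x, bwt G x B v * (-2 * u v) =
      -(∑ v ∈ Finset.univ.erase x, vw G B v * u v) - ∑ v ∈ Finset.univ.erase x, u v := by
    rw [← Finset.sum_neg_distrib, ← Finset.sum_sub_distrib]
    refine Finset.sum_congr rfl fun v hv => ?_
    rw [bwt, if_neg (Finset.ne_of_mem_erase hv)]
    ring
  have h3 : -(∑ v, vw G (fun e => exp (y e)) v * exp (-2 * u v)) / 2 =
      -(1 / 2 * vw G (fun e => exp (y e)) x) + ∑ v ∈ Finset.univ.erase x,
        -(vw G (fun e => exp (y e)) v / 2 * exp (-2 * u v)) := by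
    rw [← Finset.add_sum_erase _ _ (Finset.mem_univ x), hu, mul_zero, exp_zero,
      Finset.sum_neg_distrib]
    have : ∑ v ∈ Finset.univ.erase x, vw G (fun e => exp (y e)) v / 2 * exp (-2 * u v) =
        (∑ v ∈ Finset.univ.erase x, vw G (fun e => exp (y e)) v * exp (-2 * u v)) / 2 := by
      rw [Finset.sum_div]
      exact Finset.sum_congr rfl fun v _ => by ring
    rw [this]
    ring
  rw [h1, h2, h3, Finset.sum_neg_distrib]
  simp only [sub_eq_add_neg, exp_add, exp_neg]
  field_simp

section Marginal

variable {ι : Type*} [DecidableEq ι]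

lemma lmarginal_congr_base (s t : Finset ι) (f : (ι → ℝ) → ℝ≥0∞)
    (hf : ∀ y z, (∀ i ∈ t, y i = z i) → f y = f z) (x z : ι → ℝ)
    (hxz : ∀ i ∈ t, i ∉ s → x i = z i) :
    lmarginal (fun _ => volume) s f x = lmarginal (fun _ => volume) s f z := by
  simp only [lmarginal]
  refine lintegral_congr fun y => hf _ _ fun i hi => ?_
  by_cases h : i ∈ s
  · simp [Function.updateFinset, h]
  · simp [Function.updateFinset, h, hxz i hi h]

lemma lmarginal_congr_fun (s : Finset ι) (f g : (ι → ℝ) → ℝ≥0∞) (x : ι → ℝ)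
    (hfg : ∀ y, (∀ i ∉ s, y i = x i) → f y = g y) :
    lmarginal (fun _ => volume) s f x = lmarginal (fun _ => volume) s g x := by
  simp only [lmarginal]
  refine lintegral_congr fun y => hfg _ fun i hi => ?_
  simp [Function.updateFinset, hi]

lemma lmarginal_insert_diag [Fintype ι] (s : Finset ι) (i : ι) (hi : i ∉ s)
    (f : (ι → ℝ) → ℝ≥0∞) (hm : Measurable f)
    (hf : ∀ y z, (∀ j ∈ insert i s, y j = z j) → f y = f z) :
    lmarginal (fun _ => volume) (insert i s) f 0 =
      lmarginal (fun _ => volume) s (fun y => ∫⁻ t, f (y + fun _ => t)) 0 := by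
  rw [lmarginal_insert _ hm hi, ← lintegral_lmarginal_swap volume s (fun t y => f (y + fun _ => t))]
  · refine lintegral_congr fun t => ?_
    rw [lmarginal_comp_add, zero_add]
    refine lmarginal_congr_base s (insert i s) f hf _ _ fun j hj hjs => ?_
    obtain rfl := (Finset.mem_insert.1 hj).resolve_right hjs
    simp
  · refine hm.comp (measurable_pi_lambda _ fun j => ?_)
    exact ((measurable_pi_apply j).comp measurable_snd).add measurable_fst

end Marginal

section Weights

variable (G : SimpleGraph V) [DecidableRel G.Adj]

lemma vw_congr {w w' : Sym2 V → ℝ} (h : ∀ e ∈ G.edgeFinset, w e = w' e) (v : V) :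
    vw G w v = vw G w' v :=
  Finset.sum_congr rfl fun j hj => h _ (by simpa using hj)

lemma tau_congr {w w' : Sym2 V → ℝ} (h : ∀ e ∈ G.edgeFinset, w e = w' e) :
    tau G w = tau G w' :=
  Finset.sum_congr rfl fun _ hF => Finset.prod_congr rfl fun e he =>
    h e (Finset.mem_powerset.1 (Finset.mem_filter.1 hF).1 he)

lemma adjWeight_congr {w w' : Sym2 V → ℝ} (h : ∀ e ∈ G.edgeFinset, w e = w' e) :
    adjWeight G w = adjWeight G w' := by
  ext i j
  unfold adjWeight
  split_ifs with hij
  · exact h _ (by simpa using hij)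
  · rfl

lemma vw_const_mul (c : ℝ) (w : Sym2 V → ℝ) (v : V) :
    vw G (fun e => c * w e) v = c * vw G w v := (Finset.mul_sum _ _ _).symm

lemma tau_const_mul (c : ℝ) (w : Sym2 V → ℝ) :
    tau G (fun e => c * w e) = c ^ (Fintype.card V - 1) * tau G w := by
  obtain h | ⟨⟨x⟩⟩ := isEmpty_or_nonempty V
  · rw [tau, tau, Finset.mul_sum]
    refine Finset.sum_congr rfl fun F _ => ?_
    have : F = ∅ := Finset.eq_empty_of_forall_notMem fun e _ => by
      induction e using Sym2.ind with
      | _ p q => exact h.elim p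
    simp [this, Fintype.card_eq_zero]
  · rw [tau_eq_det_rlap _ _ x, tau_eq_det_rlap _ _ x]
    have : rlap G (fun e => c * w e) x = c • rlap G w x := by
      ext i j
      simp only [rlap, vw_const_mul, Matrix.smul_apply, smul_eq_mul]
      split_ifs <;> ring
    rw [this, Matrix.det_smul]
    simp

lemma tau_nonneg {w : Sym2 V → ℝ} (h : ∀ e ∈ G.edgeFinset, 0 ≤ w e) : 0 ≤ tau G w :=
  Finset.sum_nonneg fun _ hF => Finset.prod_nonneg fun e he =>
    h e (Finset.mem_powerset.1 (Finset.mem_filter.1 hF).1 he)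

variable {G}

lemma vw_pos (hG : G.Connected) {e0 : Sym2 V} (he0 : e0 ∈ G.edgeFinset) {w : Sym2 V → ℝ}
    (h : ∀ e ∈ G.edgeFinset, 0 < w e) (v : V) : 0 < vw G w v := by
  have : Nontrivial V := by
    induction e0 using Sym2.ind with
    | _ p q =>
      have hadj : G.Adj p q := by simpa using he0
      exact ⟨p, q, hadj.ne⟩
  obtain ⟨u, hu⟩ := hG.preconnected.exists_adj_of_nontrivial v
  exact Finset.sum_pos' (fun j hj => (h _ (by simpa using hj)).le) ⟨u, by simpa using hu,
    h _ (by simpa using hu)⟩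

lemma bwt_pos (hG : G.Connected) {e0 : Sym2 V} (he0 : e0 ∈ G.edgeFinset) {B : Sym2 V → ℝ}
    (h : ∀ e ∈ G.edgeFinset, 0 < B e) (x v : V) : 0 < bwt G x B v := by
  have := vw_pos hG he0 h v
  unfold bwt
  split_ifs <;> linarith

lemma exists_adj_boundary (hG : G.Connected) (x : V) (T : Finset V)
    (hT : T ⊆ Finset.univ.erase x) (hne : T.Nonempty) : ∃ i ∈ T, ∃ j, j ∉ T ∧ G.Adj i j := by
  obtain ⟨i, hi⟩ := hne
  obtain ⟨p⟩ := hG.preconnected i x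
  obtain ⟨d, -, h1, h2⟩ := p.exists_boundary_dart (T : Set V) hi
    (fun hx => Finset.notMem_erase x _ (hT hx))
  exact ⟨d.fst, h1, d.snd, h2, d.adj⟩

end Weights

section MagicFormula

variable (G : SimpleGraph V) [DecidableRel G.Adj]

/-- The magic-formula density in logarithmic coordinates, up to normalization. -/
def logDensity (x : V) (B y : Sym2 V → ℝ) : ℝ :=
  (∏ e ∈ G.edgeFinset, exp (B e * y e)) * √(tau G fun e => exp (y e)) *
    ∏ v, vw G (fun e => exp (y e)) v ^ (-bwt G x B v)

/-- The joint density of the gamma conductances and of the field of the vertex-reinforced jump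
process. -/
def jointDensity (x : V) (B : Sym2 V → ℝ) (u : V → ℝ) (y : Sym2 V → ℝ) : ℝ≥0∞ :=
  ENNReal.ofReal ((∏ e ∈ G.edgeFinset, (exp (B e * y e) * exp (-exp (y e)))) *
    vrjp (adjWeight G fun e => exp (y e)) x (Finset.univ.erase x) u)

lemma measurable_jointDensity (x : V) (B : Sym2 V → ℝ) :
    Measurable (Function.uncurry (jointDensity G x B)) := by
  refine (Continuous.mul (by fun_prop) (continuous_vrjp
    (fun p : (V → ℝ) × (Sym2 V → ℝ) => adjWeight G fun e => exp (p.2 e)) (fun p => p.1)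
    (fun i j => ?_) (fun _ => by fun_prop) x _)).measurable.ennreal_ofReal
  unfold adjWeight
  split_ifs <;> fun_prop

lemma continuous_vw {α : Type*} [TopologicalSpace α] {w : α → Sym2 V → ℝ}
    (hw : ∀ e, Continuous fun p => w p e) (v : V) : Continuous fun p => vw G (w p) v := by
  unfold vw; fun_prop

lemma continuous_tau {α : Type*} [TopologicalSpace α] {w : α → Sym2 V → ℝ}
    (hw : ∀ e, Continuous fun p => w p e) : Continuous fun p => tau G (w p) := by
  unfold tau; fun_prop

variable {G}

lemma lmarginal_jointDensity (hG : G.Connected) (x : V) {B : Sym2 V → ℝ}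
    (hB : ∀ e ∈ G.edgeFinset, 0 < B e) :
    lmarginal (fun _ => volume) G.edgeFinset (fun y => lmarginal (fun _ => volume)
      (Finset.univ.erase x) (fun u => jointDensity G x B u y) 0) 0 =
    (∏ e ∈ G.edgeFinset, ENNReal.ofReal (Gamma (B e))) *
      ENNReal.ofReal √(2 * π) ^ (Finset.univ.erase x).card := by
  have hin : ∀ y : Sym2 V → ℝ, lmarginal (fun _ => volume)
      (Finset.univ.erase x) (fun u => jointDensity G x B u y) 0 =
      ENNReal.ofReal √(2 * π) ^ (Finset.univ.erase x).card *
        ∏ e ∈ G.edgeFinset, ENNReal.ofReal (exp (B e * y e) * exp (-exp (y e))) := by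
    intro y
    have hpos : ∀ e ∈ G.edgeFinset, 0 ≤ exp (B e * y e) * exp (-exp (y e)) :=
      fun e _ => by positivity
    simp only [jointDensity, ENNReal.ofReal_mul (Finset.prod_nonneg hpos)]
    rw [lmarginal_const_mul, lmarginal_vrjp, mul_comm, ENNReal.ofReal_prod_of_nonneg hpos]
    · exact Finset.notMem_erase x _
    · exact adjWeight_comm G _
    · intro i j
      unfold adjWeight
      split_ifs <;> positivity
    · intro T hT hne
      obtain ⟨i, hi, j, hj, hij⟩ := exists_adj_boundary hG x T hT hne
      refine ⟨i, hi, j, by simp [Finset.insert_erase], hj, ?_⟩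
      rw [adjWeight, if_pos hij]
      exact exp_pos _
    · exact (continuous_vrjp (fun _ => adjWeight G fun e => exp (y e)) (fun u => u)
        (fun _ _ => continuous_const) (fun _ => by fun_prop) x _).measurable.ennreal_ofReal
  simp only [hin]
  rw [lmarginal_const_mul, lmarginal_prod _ (fun e t =>
    ENNReal.ofReal (exp (B e * t) * exp (-exp t))) (fun e => by fun_prop), mul_comm]
  · congr 1
    refine Finset.prod_congr rfl fun e he => ?_
    have h := lintegral_exp_mul_exp_neg_exp (hB e he) one_pos one_ne_zero
    simp only [one_mul, one_rpow, mul_one, abs_one, div_one] at h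
    exact h
  · fun_prop

lemma lmarginal_jointDensity_shift (hG : G.Connected) {e0 : Sym2 V} (he0 : e0 ∈ G.edgeFinset)
    (x : V) {B : Sym2 V → ℝ} (hB : ∀ e ∈ G.edgeFinset, 0 < B e) :
    lmarginal (fun _ => volume) G.edgeFinset (fun y => lmarginal (fun _ => volume)
      (Finset.univ.erase x) (fun u => jointDensity G x B u y) 0) 0 =
    lmarginal (fun _ => volume) G.edgeFinset (fun y =>
      ENNReal.ofReal ((∏ e ∈ G.edgeFinset, exp (B e * y e)) * √(tau G fun e => exp (y e)) *
        exp (-(1 / 2 * vw G (fun e => exp (y e)) x))) *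
      ∏ v ∈ Finset.univ.erase x, ENNReal.ofReal (Gamma (bwt G x B v) *
        (vw G (fun e => exp (y e)) v / 2) ^ (-bwt G x B v) / 2)) 0 := by
  set h0 : (Sym2 V → ℝ) → ℝ := fun y =>
    (∏ e ∈ G.edgeFinset, exp (B e * y e)) * √(tau G fun e => exp (y e)) *
      exp (-(1 / 2 * vw G (fun e => exp (y e)) x)) with hh0
  have hcv : ∀ v, Continuous fun y : Sym2 V → ℝ => vw G (fun e => exp (y e)) v :=
    continuous_vw G (by fun_prop)
  have hct : Continuous fun y : Sym2 V → ℝ => tau G (fun e => exp (y e)) :=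
    continuous_tau G (by fun_prop)
  have hh0c : Continuous h0 := by
    have := hcv x
    rw [hh0]; fun_prop
  set k : V → (Sym2 V → ℝ) → ℝ → ℝ := fun v y t => exp (bwt G x B v * (-2 * t)) *
    exp (-(vw G (fun e => exp (y e)) v / 2 * exp (-2 * t))) with hk
  have hkm : ∀ v y, Measurable fun t => ENNReal.ofReal (k v y t) := by
    intro v y; rw [hk]; fun_prop
  have hkm2 : ∀ v, Continuous fun p : (V → ℝ) × (Sym2 V → ℝ) => k v p.2 (p.1 v) := by
    intro v
    have : Continuous fun p : (V → ℝ) × (Sym2 V → ℝ) => vw G (fun e => exp (p.2 e)) v :=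
      continuous_vw G (by fun_prop) v
    rw [hk]; fun_prop
  have hshift : ∀ u : V → ℝ, u x = 0 →
      lmarginal (fun _ => volume) G.edgeFinset (jointDensity G x B u) 0 =
      lmarginal (fun _ => volume) G.edgeFinset (fun y => ENNReal.ofReal (h0 y) *
        ∏ v ∈ Finset.univ.erase x, ENNReal.ofReal (k v y (u v))) 0 := by
    intro u hu
    have hdep : ∀ y z : Sym2 V → ℝ, (∀ e ∈ G.edgeFinset, y e = z e) →
        jointDensity G x B u y = jointDensity G x B u z := by
      intro y z hyz
      rw [jointDensity, jointDensity, adjWeight_congr G (w' := fun e => exp (z e))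
        (fun e he => by rw [hyz e he]), Finset.prod_congr rfl fun e he => by rw [hyz e he]]
    rw [lmarginal_congr_base _ _ _ hdep 0 (0 + fun e => -ssum u e)
      (fun e he he' => absurd he he'), ← lmarginal_comp_add]
    congr 1
    ext y
    have h := prod_mul_vrjp_shift G x B y u hu
    simp only [jointDensity, Pi.add_apply, ← sub_eq_add_neg]
    rw [h, ENNReal.ofReal_mul (by positivity), ENNReal.ofReal_prod_of_nonneg
      (fun v _ => by positivity)]
  rw [← lmarginal_swap _ _ _ (measurable_jointDensity G x B),
    lmarginal_congr_fun _ _ (fun u => lmarginal (fun _ => volume) G.edgeFinset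
      (fun y => ENNReal.ofReal (h0 y) *
        ∏ v ∈ Finset.univ.erase x, ENNReal.ofReal (k v y (u v))) 0) _
      (fun u hu => hshift u (hu x (Finset.notMem_erase x _))), lmarginal_swap]
  · congr 1
    ext y
    rw [lmarginal_const_mul, lmarginal_prod _ (fun v t => ENNReal.ofReal (k v y t)) (hkm · y)]
    · congr 1
      refine Finset.prod_congr rfl fun v _ => ?_
      have h := lintegral_exp_mul_exp_neg_exp (bwt_pos hG he0 hB x v)
        (half_pos (vw_pos hG he0 (fun e _ => exp_pos (y e)) v))
        (show (-2 : ℝ) ≠ 0 by norm_num)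
      rw [show |(-2 : ℝ)| = 2 by norm_num] at h
      exact h
    · exact Finset.measurable_fun_prod _ fun v _ => (hkm v y).comp (measurable_pi_apply v)
  · refine (hh0c.measurable.ennreal_ofReal.comp measurable_snd).mul ?_
    exact Finset.measurable_fun_prod _ fun v _ => (hkm2 v).measurable.ennreal_ofReal

end MagicFormula

section MagicFormula

variable {G : SimpleGraph V} [DecidableRel G.Adj]

lemma sum_bwt (x : V) (B : Sym2 V → ℝ) :
    ∑ v, bwt G x B v = ∑ e ∈ G.edgeFinset, B e + ((Fintype.card V : ℝ) - 1) / 2 := by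
  simp only [bwt, ← Finset.sum_div, Finset.sum_sub_distrib, Finset.sum_add_distrib, sum_vw,
    Finset.sum_ite_eq', Finset.mem_univ, if_true, Finset.sum_const, Finset.card_univ, nsmul_eq_mul]
  ring

lemma Znorm_pos (hG : G.Connected) {e0 : Sym2 V} (he0 : e0 ∈ G.edgeFinset) (x : V)
    {B : Sym2 V → ℝ} (hB : ∀ e ∈ G.edgeFinset, 0 < B e) : 0 < Znorm G x B := by
  have h1 : 0 < ∏ e ∈ G.edgeFinset, Gamma (B e) :=
    Finset.prod_pos fun e he => Gamma_pos_of_pos (hB e he)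
  have h2 : 0 < ∏ v, Gamma (bwt G x B v) :=
    Finset.prod_pos fun v _ => Gamma_pos_of_pos (bwt_pos hG he0 hB x v)
  unfold Znorm
  positivity

lemma Znorm_identity (hG : G.Connected) {e0 : Sym2 V} (he0 : e0 ∈ G.edgeFinset) (x : V)
    {B : Sym2 V → ℝ} (hB : ∀ e ∈ G.edgeFinset, 0 < B e) :
    (∏ v ∈ Finset.univ.erase x, (Gamma (bwt G x B v) * 2 ^ bwt G x B v / 2)) *
      (Gamma (bwt G x B x) * 2 ^ bwt G x B x) * Znorm G x B =
    (∏ e ∈ G.edgeFinset, Gamma (B e)) * √(2 * π) ^ (Finset.univ.erase x).card := by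
  have hΓ : (∏ v, Gamma (bwt G x B v)) ≠ 0 :=
    Finset.prod_ne_zero_iff.2 fun v _ => (Gamma_pos_of_pos (bwt_pos hG he0 hB x v)).ne'
  have h1 : (∏ v ∈ Finset.univ.erase x, (Gamma (bwt G x B v) * 2 ^ bwt G x B v / 2)) *
      (Gamma (bwt G x B x) * 2 ^ bwt G x B x) =
      (∏ v, Gamma (bwt G x B v)) * 2 ^ (∑ v, bwt G x B v) / 2 ^ (Finset.univ.erase x).card := by
    rw [rpow_sum_of_pos two_pos, ← Finset.prod_mul_distrib,
      ← Finset.mul_prod_erase _ _ (Finset.mem_univ x), Finset.prod_div_distrib, Finset.prod_const]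
    ring
  have hcard : ((Finset.univ.erase x).card : ℝ) = (Fintype.card V : ℝ) - 1 := by
    rw [Finset.card_erase_of_mem (Finset.mem_univ x), Finset.card_univ,
      Nat.cast_sub (Fintype.card_pos_iff.2 ⟨x⟩), Nat.cast_one]
  have h2 : √(2 * π) ^ (Finset.univ.erase x).card =
      2 ^ (((Fintype.card V : ℝ) - 1) / 2) * π ^ (((Fintype.card V : ℝ) - 1) / 2) := by
    rw [← rpow_natCast, hcard, sqrt_eq_rpow, ← rpow_mul (by positivity),
      ← mul_rpow two_pos.le pi_pos.le]
    congr 1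
    ring
  have h3 : (2 : ℝ) ^ (Finset.univ.erase x).card = 2 ^ ((Fintype.card V : ℝ) - 1) := by
    rw [← rpow_natCast, hcard]
  have h4 : (2 : ℝ) ^ (∑ v, bwt G x B v) = 2 ^ ((Fintype.card V : ℝ) - 1) *
      2 ^ ((1 : ℝ) - (Fintype.card V : ℝ) + ∑ e ∈ G.edgeFinset, B e) *
      2 ^ (((Fintype.card V : ℝ) - 1) / 2) := by
    rw [← rpow_add two_pos, ← rpow_add two_pos, sum_bwt]
    congr 1
    ring
  rw [h1, h2, h3, h4, Znorm]
  field_simp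

lemma lintegral_scale (hG : G.Connected) {e0 : Sym2 V} (he0 : e0 ∈ G.edgeFinset)
    (x : V) {B : Sym2 V → ℝ} (hB : ∀ e ∈ G.edgeFinset, 0 < B e) (y : Sym2 V → ℝ) :
    ∫⁻ t : ℝ, ENNReal.ofReal ((∏ e ∈ G.edgeFinset, exp (B e * (y e + t))) *
      √(tau G fun e => exp (y e + t)) *
      (∏ v ∈ Finset.univ.erase x, vw G (fun e => exp (y e + t)) v ^ (-bwt G x B v)) *
      exp (-(1 / 2 * vw G (fun e => exp (y e + t)) x))) =
    ENNReal.ofReal (Gamma (bwt G x B x) * 2 ^ bwt G x B x) *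
      ENNReal.ofReal (logDensity G x B y) := by
  have hw : ∀ v, 0 < vw G (fun e => exp (y e)) v := vw_pos hG he0 fun e _ => exp_pos (y e)
  have hτ : 0 ≤ tau G fun e => exp (y e) := tau_nonneg G fun e _ => (exp_pos _).le
  have hP : 0 ≤ ∏ v ∈ Finset.univ.erase x, vw G (fun e => exp (y e)) v ^ (-bwt G x B v) :=
    Finset.prod_nonneg fun v _ => rpow_nonneg (hw v).le _
  have hcard : (((Fintype.card V - 1 : ℕ)) : ℝ) = (Fintype.card V : ℝ) - 1 := by
    rw [Nat.cast_sub (Fintype.card_pos_iff.2 ⟨x⟩), Nat.cast_one]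
  have hscale : ∀ t : ℝ, (∏ e ∈ G.edgeFinset, exp (B e * (y e + t))) *
      √(tau G fun e => exp (y e + t)) *
      (∏ v ∈ Finset.univ.erase x, vw G (fun e => exp (y e + t)) v ^ (-bwt G x B v)) *
      exp (-(1 / 2 * vw G (fun e => exp (y e + t)) x)) =
      ((∏ e ∈ G.edgeFinset, exp (B e * y e)) * √(tau G fun e => exp (y e)) *
        ∏ v ∈ Finset.univ.erase x, vw G (fun e => exp (y e)) v ^ (-bwt G x B v)) *
      (exp (bwt G x B x * (1 * t)) *
        exp (-(1 / 2 * vw G (fun e => exp (y e)) x * exp (1 * t)))) := by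
    intro t
    have he : (fun e => exp (y e + t)) = fun e => exp t * exp (y e) := by
      ext e; rw [add_comm, exp_add]
    have h1 : ∏ e ∈ G.edgeFinset, exp (B e * (y e + t)) =
        (∏ e ∈ G.edgeFinset, exp (B e * y e)) * exp ((∑ e ∈ G.edgeFinset, B e) * t) := by
      simp only [mul_add, exp_add, Finset.prod_mul_distrib]
      rw [Finset.sum_mul, exp_sum]
    have h2 : √(exp t ^ (Fintype.card V - 1)) = exp (((Fintype.card V : ℝ) - 1) / 2 * t) := by
      rw [← exp_nat_mul, ← exp_half, hcard]
      congr 1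
      ring
    have h3 : ∏ v ∈ Finset.univ.erase x, (exp t * vw G (fun e => exp (y e)) v) ^ (-bwt G x B v) =
        (∏ v ∈ Finset.univ.erase x, vw G (fun e => exp (y e)) v ^ (-bwt G x B v)) *
        exp (-(∑ v ∈ Finset.univ.erase x, bwt G x B v) * t) := by
      rw [← Finset.sum_neg_distrib, Finset.sum_mul, exp_sum, ← Finset.prod_mul_distrib]
      refine Finset.prod_congr rfl fun v _ => ?_
      rw [mul_rpow (exp_pos _).le (hw v).le, ← exp_mul, mul_comm, mul_comm t]
    have h4 : exp (bwt G x B x * (1 * t)) = exp ((∑ e ∈ G.edgeFinset, B e) * t) *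
        exp (((Fintype.card V : ℝ) - 1) / 2 * t) *
        exp (-(∑ v ∈ Finset.univ.erase x, bwt G x B v) * t) := by
      have := sum_bwt (G := G) x B
      rw [← Finset.add_sum_erase _ _ (Finset.mem_univ x)] at this
      rw [← exp_add, ← exp_add]
      congr 1
      linear_combination t * this
    rw [he, tau_const_mul, Real.sqrt_mul (by positivity), h2, h1, h4]
    simp only [vw_const_mul]
    rw [h3, one_mul]
    ring_nf
  simp only [hscale]
  have hk : 0 ≤ (∏ e ∈ G.edgeFinset, exp (B e * y e)) * √(tau G fun e => exp (y e)) *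
      ∏ v ∈ Finset.univ.erase x, vw G (fun e => exp (y e)) v ^ (-bwt G x B v) := by positivity
  simp only [ENNReal.ofReal_mul hk]
  have hb := bwt_pos hG he0 hB x x
  rw [lintegral_const_mul _ (by fun_prop), lintegral_exp_mul_exp_neg_exp hb
    (mul_pos one_half_pos (hw x)) one_ne_zero, ← ENNReal.ofReal_mul hk, ← ENNReal.ofReal_mul
      (mul_pos (Gamma_pos_of_pos hb) (by positivity)).le, logDensity,
    ← Finset.mul_prod_erase _ _ (Finset.mem_univ x), mul_rpow (by norm_num) (hw x).le,
    one_div, inv_rpow two_pos.le, rpow_neg two_pos.le, inv_inv]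
  congr 1
  rw [abs_one, div_one]
  ring

/-- The magic formula: the total mass of the unnormalized density, in logarithmic coordinates. -/
theorem lmarginal_logDensity (hG : G.Connected) {e0 : Sym2 V} (he0 : e0 ∈ G.edgeFinset)
    (x : V) {B : Sym2 V → ℝ} (hB : ∀ e ∈ G.edgeFinset, 0 < B e) :
    lmarginal (fun _ => volume) (G.edgeFinset.erase e0)
      (fun y => ENNReal.ofReal (logDensity G x B y)) 0 = ENNReal.ofReal (Znorm G x B) := by
  have hcv : ∀ v, Continuous fun y : Sym2 V → ℝ => vw G (fun e => exp (y e)) v :=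
    continuous_vw G (by fun_prop)
  have hct : Continuous fun y : Sym2 V → ℝ => tau G (fun e => exp (y e)) :=
    continuous_tau G (by fun_prop)
  have hw : ∀ (y : Sym2 V → ℝ) v, 0 < vw G (fun e => exp (y e)) v := fun y =>
    vw_pos hG he0 fun e _ => exp_pos (y e)
  have hb := bwt_pos hG he0 hB x
  have hrp : ∀ v, Continuous fun y : Sym2 V → ℝ =>
      vw G (fun e => exp (y e)) v ^ (-bwt G x B v) := fun v =>
    (hcv v).rpow_const fun y => Or.inl (hw y v).ne'
  set h : (Sym2 V → ℝ) → ℝ := fun y => (∏ e ∈ G.edgeFinset, exp (B e * y e)) *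
      √(tau G fun e => exp (y e)) *
      (∏ v ∈ Finset.univ.erase x, vw G (fun e => exp (y e)) v ^ (-bwt G x B v)) *
      exp (-(1 / 2 * vw G (fun e => exp (y e)) x)) with hh
  have hhc : Continuous h := by
    have := hcv x
    rw [hh]; fun_prop
  have hlc : Continuous (logDensity G x B) := by
    unfold logDensity; fun_prop
  have hC1 : ∀ v ∈ Finset.univ.erase x, 0 ≤ Gamma (bwt G x B v) * 2 ^ bwt G x B v / 2 :=
    fun v _ => by have := Gamma_pos_of_pos (hb v); positivity
  have hfac : ∀ y : Sym2 V → ℝ,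
      ENNReal.ofReal ((∏ e ∈ G.edgeFinset, exp (B e * y e)) * √(tau G fun e => exp (y e)) *
        exp (-(1 / 2 * vw G (fun e => exp (y e)) x))) *
      ∏ v ∈ Finset.univ.erase x, ENNReal.ofReal (Gamma (bwt G x B v) *
        (vw G (fun e => exp (y e)) v / 2) ^ (-bwt G x B v) / 2) =
      ENNReal.ofReal (∏ v ∈ Finset.univ.erase x, (Gamma (bwt G x B v) * 2 ^ bwt G x B v / 2)) *
        ENNReal.ofReal (h y) := by
    intro y
    rw [← ENNReal.ofReal_prod_of_nonneg, ← ENNReal.ofReal_mul (by positivity),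
      ← ENNReal.ofReal_mul (Finset.prod_nonneg hC1)]
    · congr 1
      have : ∀ v, Gamma (bwt G x B v) * (vw G (fun e => exp (y e)) v / 2) ^ (-bwt G x B v) / 2 =
          (Gamma (bwt G x B v) * 2 ^ bwt G x B v / 2) *
            vw G (fun e => exp (y e)) v ^ (-bwt G x B v) := by
        intro v
        rw [div_rpow (hw y v).le two_pos.le, rpow_neg two_pos.le, div_inv_eq_mul]
        ring
      simp only [this, hh]
      rw [Finset.prod_mul_distrib]
      ring
    · intro v _
      have := Gamma_pos_of_pos (hb v)
      have := hw y v
      positivity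
  have h1 := lmarginal_jointDensity_shift hG he0 x hB
  rw [lmarginal_jointDensity hG x hB] at h1
  simp only [hfac] at h1
  rw [lmarginal_const_mul _ _ _ hhc.measurable.ennreal_ofReal] at h1
  have hins : insert e0 (G.edgeFinset.erase e0) = G.edgeFinset := Finset.insert_erase he0
  have h2 := lmarginal_insert_diag (G.edgeFinset.erase e0) e0 (Finset.notMem_erase _ _)
    (fun y => ENNReal.ofReal (h y)) hhc.measurable.ennreal_ofReal (by
      rw [hins]
      intro y z hyz
      have h3 : ∀ e ∈ G.edgeFinset, exp (y e) = exp (z e) := fun e he => by rw [hyz e he]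
      simp only [hh]
      rw [tau_congr G h3, Finset.prod_congr rfl fun e he => by rw [hyz e he]]
      simp only [vw_congr G h3])
  rw [hins] at h2
  rw [h2] at h1
  simp only [hh, Pi.add_apply, lintegral_scale hG he0 x hB] at h1
  have hg := Gamma_pos_of_pos (hb x)
  rw [lmarginal_const_mul _ _ _ hlc.measurable.ennreal_ofReal,
    ← ENNReal.ofReal_pow (by positivity), ← ENNReal.ofReal_prod_of_nonneg
      (fun e he => (Gamma_pos_of_pos (hB e he)).le), ← ENNReal.ofReal_mul (Finset.prod_nonneg
      fun e he => (Gamma_pos_of_pos (hB e he)).le), ← Znorm_identity hG he0 x hB,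
    ← mul_assoc (ENNReal.ofReal _),
    ← ENNReal.ofReal_mul (Finset.prod_nonneg hC1)] at h1
  have hpos : 0 < (∏ v ∈ Finset.univ.erase x, (Gamma (bwt G x B v) * 2 ^ bwt G x B v / 2)) *
      (Gamma (bwt G x B x) * 2 ^ bwt G x B x) :=
    mul_pos (Finset.prod_pos fun v _ => by have := Gamma_pos_of_pos (hb v); positivity)
      (by positivity)
  rw [ENNReal.ofReal_mul hpos.le] at h1
  exact ((ENNReal.mul_right_inj (ENNReal.ofReal_pos.2 hpos).ne' ENNReal.ofReal_ne_top).1 h1).symm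

end MagicFormula

lemma lintegral_pi_Ioi_eq {α : Type*} [Fintype α] [DecidableEq α] (F : (α → ℝ) → ℝ≥0∞) :
    ∫⁻ u in {u : α → ℝ | ∀ i, 0 < u i}, F u =
      ∫⁻ y : α → ℝ, ENNReal.ofReal (∏ i, exp (y i)) * F fun i => exp (y i) := by
  have himg : (fun (y : α → ℝ) i => exp (y i)) '' Set.univ = {u : α → ℝ | ∀ i, 0 < u i} := by
    ext u
    simp only [Set.image_univ, Set.mem_range, Set.mem_ofPred_eq]
    refine ⟨fun ⟨y, hy⟩ i => hy ▸ exp_pos _, fun h => ⟨fun i => log (u i), ?_⟩⟩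
    ext i
    exact exp_log (h i)
  have h := lintegral_image_eq_lintegral_abs_det_fderiv_mul volume (s := Set.univ)
    (f := fun (y : α → ℝ) i => exp (y i))
    (f' := fun y => ContinuousLinearMap.pi fun i =>
      exp (y i) • (ContinuousLinearMap.proj i : (α → ℝ) →L[ℝ] ℝ)) MeasurableSet.univ
    (fun y _ => (hasFDerivAt_pi.2 fun i => ((hasFDerivAt_apply i y).exp)).hasFDerivWithinAt)
    (fun a _ b _ hab => funext fun i => exp_injective (congrFun hab i)) F
  rw [himg, setLIntegral_univ] at h
  rw [h]
  refine lintegral_congr fun y => ?_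
  have hdet : (ContinuousLinearMap.pi fun i =>
      exp (y i) • (ContinuousLinearMap.proj i : (α → ℝ) →L[ℝ] ℝ)).det = ∏ i, exp (y i) := by
    rw [ContinuousLinearMap.det, ← Matrix.det_diagonal, ← LinearMap.det_toLin']
    congr 1
    ext v i
    simp [Matrix.mulVec_diagonal]
  rw [hdet, abs_of_pos (Finset.prod_pos fun i _ => exp_pos _)]

section MagicFormula

variable {G : SimpleGraph V} [DecidableRel G.Adj]

lemma magicDensity_eq (hG : G.Connected) {e0 : Sym2 V} (he0 : e0 ∈ G.edgeFinset) (x : V)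
    (B : Sym2 V → ℝ) {w : Sym2 V → ℝ} (hw : ∀ e ∈ G.edgeFinset, 0 < w e) :
    magicDensity G x B w = (Znorm G x B)⁻¹ * ((∏ e ∈ G.edgeFinset, w e ^ (B e - 1)) *
      √(tau G w) * ∏ v, vw G w v ^ (-bwt G x B v)) := by
  have hv := vw_pos hG he0 hw
  have h : vw G w x ^ ((1 : ℝ) / 2) / (∏ v : V, vw G w v ^ ((vw G B v + 1) / 2)) =
      ∏ v, vw G w v ^ (-bwt G x B v) := by
    have h1 : vw G w x ^ ((1 : ℝ) / 2) =
        ∏ v, vw G w v ^ ((if v = x then (1 : ℝ) else 0) / 2) := by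
      rw [Finset.prod_eq_single x (fun v _ hvx => by simp [hvx]) (by simp), if_pos rfl]
    rw [h1, ← Finset.prod_div_distrib]
    refine Finset.prod_congr rfl fun v _ => ?_
    rw [← rpow_sub (hv v), bwt]
    congr 1
    ring
  rw [magicDensity, ← h]
  ring

/-- Integrating over the coordinates other than `e0`, set to zero at `e0`, as a marginal. -/
lemma lintegral_pinned_eq_lmarginal (G : SimpleGraph V) [DecidableRel G.Adj] (e0 : Sym2 V)
    (F : (Sym2 V → ℝ) → ℝ≥0∞) :
    ∫⁻ y : Epin G e0 → ℝ, F (fun e => if h : e ∈ G.edgeFinset ∧ e ≠ e0 then y ⟨e, h⟩ else 0) =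
      lmarginal (fun _ => volume) (G.edgeFinset.erase e0) F 0 := by
  have hmem : ∀ e, e ∈ G.edgeFinset ∧ e ≠ e0 ↔ e ∈ G.edgeFinset.erase e0 := fun e => by
    rw [Finset.mem_erase, and_comm]
  have hp := volume_measurePreserving_piCongrLeft (fun _ : G.edgeFinset.erase e0 => ℝ)
    (Equiv.subtypeEquivRight hmem)
  have h := hp.lintegral_comp_emb (MeasurableEquiv.measurableEmbedding _)
    (fun y => F (Function.updateFinset 0 (G.edgeFinset.erase e0) y))
  refine Eq.trans (lintegral_congr fun y => ?_) h
  congr 1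
  ext e
  by_cases he : e ∈ G.edgeFinset.erase e0
  · rw [dif_pos ((hmem e).2 he), Function.updateFinset, dif_pos he]
    exact (Equiv.piCongrLeft_apply_apply (fun _ : G.edgeFinset.erase e0 => ℝ)
      (Equiv.subtypeEquivRight hmem) y ⟨e, (hmem e).2 he⟩).symm
  · rw [dif_neg (mt (hmem e).1 he), Function.updateFinset, dif_neg he]
    rfl

lemma pinExt_pos_iff {e0 : Sym2 V} {u : Epin G e0 → ℝ} :
    (∀ e ∈ G.edgeFinset, 0 < pinExt G e0 u e) ↔ ∀ i, 0 < u i := by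
  refine ⟨fun h i => ?_, fun h e he => ?_⟩
  · have := h i i.2.1
    rwa [pinExt, if_neg i.2.2, dif_pos i.2] at this
  · unfold pinExt
    split_ifs with h1 h2
    · exact one_pos
    · exact h _
    · exact absurd ⟨he, h1⟩ h2

/-- The mixing measure of the magic formula is a probability measure. -/
theorem lintegral_magicDensity (hG : G.Connected) {e0 : Sym2 V} (he0 : e0 ∈ G.edgeFinset)
    (x : V) {B : Sym2 V → ℝ} (hB : ∀ e ∈ G.edgeFinset, 0 < B e) :
    ∫⁻ u in {u : Epin G e0 → ℝ | ∀ i, 0 < u i},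
      ENNReal.ofReal (magicDensity G x B (pinExt G e0 u)) = 1 := by
  have hZ := Znorm_pos hG he0 x hB
  have hF : ∀ y : Epin G e0 → ℝ, ENNReal.ofReal (∏ i, exp (y i)) *
      ENNReal.ofReal (magicDensity G x B (pinExt G e0 fun i => exp (y i))) =
      ENNReal.ofReal (Znorm G x B)⁻¹ * ENNReal.ofReal (logDensity G x B
        (fun e => if h : e ∈ G.edgeFinset ∧ e ≠ e0 then y ⟨e, h⟩ else 0)) := by
    intro y
    set z : Sym2 V → ℝ :=
      fun e => if h : e ∈ G.edgeFinset ∧ e ≠ e0 then y ⟨e, h⟩ else 0 with hz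
    have hpin : ∀ e ∈ G.edgeFinset, pinExt G e0 (fun i => exp (y i)) e = exp (z e) := by
      intro e he
      by_cases h : e = e0
      · simp [pinExt, hz, h]
      · simp only [pinExt, hz, h, if_false]
        rw [dif_pos ⟨he, h⟩, dif_pos ⟨he, h⟩]
    have hprod : ∏ i, exp (y i) = ∏ e ∈ G.edgeFinset, exp (z e) := by
      have h0 : exp (z e0) = 1 := by simp [hz]
      have hsub : ∏ e ∈ G.edgeFinset.erase e0, exp (z e) = ∏ i : Epin G e0, exp (z i) :=
        Finset.prod_subtype _ (fun e => by rw [Finset.mem_erase, and_comm]) _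
      rw [← Finset.mul_prod_erase _ _ he0, h0, one_mul, hsub]
      refine Finset.prod_congr rfl fun i _ => ?_
      simp only [hz]
      rw [dif_pos i.2]
    have hpow : ∏ e ∈ G.edgeFinset, pinExt G e0 (fun i => exp (y i)) e ^ (B e - 1) =
        ∏ e ∈ G.edgeFinset, exp (z e) ^ (B e - 1) :=
      Finset.prod_congr rfl fun e he => by rw [hpin e he]
    rw [magicDensity_eq hG he0 x B (pinExt_pos_iff.2 fun i => exp_pos _), tau_congr G hpin,
      hpow, hprod,
      ← ENNReal.ofReal_mul (by positivity), ← ENNReal.ofReal_mul (by positivity), logDensity]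
    simp only [vw_congr G hpin]
    congr 1
    have : ∏ e ∈ G.edgeFinset, exp (B e * z e) =
        (∏ e ∈ G.edgeFinset, exp (z e)) * ∏ e ∈ G.edgeFinset, exp (z e) ^ (B e - 1) := by
      rw [← Finset.prod_mul_distrib]
      refine Finset.prod_congr rfl fun e _ => ?_
      rw [← exp_mul, ← exp_add]
      ring_nf
    rw [this]
    ring
  rw [lintegral_pi_Ioi_eq]
  simp only [hF]
  rw [lintegral_const_mul', lintegral_pinned_eq_lmarginal G e0
    (fun z => ENNReal.ofReal (logDensity G x B z)), lmarginal_logDensity hG he0 x hB,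
    ← ENNReal.ofReal_mul (inv_pos.2 hZ).le, inv_mul_cancel₀ hZ.ne', ENNReal.ofReal_one]
  exact ENNReal.ofReal_ne_top

end MagicFormula

section EdgeRatio

variable {G : SimpleGraph V} [DecidableRel G.Adj]

/-- The weight of an edge relative to the geometric mean of its endpoint weights. -/
def edgeRatio (G : SimpleGraph V) [DecidableRel G.Adj] (w : Sym2 V → ℝ) (e : Sym2 V) : ℝ :=
  w e / √(sprod (vw G w) e)

/-- The weights `a` with the weight of the edge `e` increased by `θ`. -/
def addWeight (a : Sym2 V → ℝ) (e : Sym2 V) (θ : ℝ) : Sym2 V → ℝ :=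
  fun g => a g + if g = e then θ else 0

lemma prod_ite_mem_edge {e : Sym2 V} (he : e ∈ G.edgeFinset) (f : V → ℝ) :
    ∏ v, (if v ∈ e then f v else 1) = sprod f e := by
  induction e using Sym2.ind with
  | _ i j =>
    have hij : i ≠ j := G.ne_of_adj (by simpa using he)
    have h : ∀ v, (if v ∈ s(i, j) then f v else 1) =
        (if v = i then f v else 1) * (if v = j then f v else 1) := by
      intro v
      by_cases h1 : v = i
      · subst h1
        simp [hij]
      · simp [h1]
    simp only [h, Finset.prod_mul_distrib, Finset.prod_ite_eq', Finset.mem_univ, if_true]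
    rfl

lemma vw_addWeight (a : Sym2 V → ℝ) {e : Sym2 V} (he : e ∈ G.edgeFinset) (θ : ℝ) (v : V) :
    vw G (addWeight a e θ) v = vw G a v + if v ∈ e then θ else 0 := by
  simp only [vw, addWeight, Finset.sum_add_distrib]
  congr 1
  split_ifs with hv
  · obtain ⟨j, rfl⟩ := hv
    rw [Finset.sum_eq_single_of_mem j (by simpa using he), if_pos rfl]
    intro k _ hk
    rw [if_neg fun h => hk (Sym2.congr_right.1 h)]
  · exact Finset.sum_eq_zero fun k _ => if_neg fun h => hv (by rw [← h]; exact Sym2.mem_mk_left v k)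

lemma bwt_addWeight (x : V) (a : Sym2 V → ℝ) {e : Sym2 V} (he : e ∈ G.edgeFinset) (θ : ℝ)
    (v : V) : bwt G x (addWeight a e θ) v = bwt G x a v + if v ∈ e then θ / 2 else 0 := by
  rw [bwt, bwt, vw_addWeight a he]
  split_ifs <;> ring

lemma addWeight_pos {a : Sym2 V → ℝ} (ha : ∀ e ∈ G.edgeFinset, 0 < a e) (e : Sym2 V) {θ : ℝ}
    (hθ : 0 ≤ θ) : ∀ g ∈ G.edgeFinset, 0 < addWeight a e θ g := by
  intro g hg
  have := ha g hg
  unfold addWeight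
  split_ifs <;> linarith

lemma vw_le_sum {w : Sym2 V → ℝ} (hw : ∀ e ∈ G.edgeFinset, 0 < w e) (i : V) :
    vw G w i ≤ ∑ g ∈ G.edgeFinset, w g := by
  rw [vw, ← Finset.sum_image (f := w) (s := G.neighborFinset i) (g := fun j => s(i, j))
    (fun _ _ _ _ h => Sym2.congr_right.1 h)]
  refine Finset.sum_le_sum_of_subset_of_nonneg ?_ fun g hg _ => (hw g hg).le
  intro g hg
  obtain ⟨k, hk, rfl⟩ := Finset.mem_image.1 hg
  simpa using hk

lemma sprod_vw_pos (hG : G.Connected) {w : Sym2 V → ℝ} (hw : ∀ e ∈ G.edgeFinset, 0 < w e)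
    {e : Sym2 V} (he : e ∈ G.edgeFinset) : 0 < sprod (vw G w) e := by
  have hv := vw_pos hG he hw
  rw [← prod_ite_mem_edge he]
  refine Finset.prod_pos fun v _ => ?_
  split_ifs
  exacts [hv v, one_pos]

lemma edgeRatio_pos (hG : G.Connected) {w : Sym2 V → ℝ} (hw : ∀ e ∈ G.edgeFinset, 0 < w e)
    {e : Sym2 V} (he : e ∈ G.edgeFinset) : 0 < edgeRatio G w e :=
  div_pos (hw e he) (sqrt_pos.2 (sprod_vw_pos hG hw he))

lemma edgeRatio_le_one (hG : G.Connected) {w : Sym2 V → ℝ}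
    (hw : ∀ e ∈ G.edgeFinset, 0 < w e) {e : Sym2 V} (he : e ∈ G.edgeFinset) :
    edgeRatio G w e ≤ 1 := by
  rw [edgeRatio, div_le_one (sqrt_pos.2 (sprod_vw_pos hG hw he))]
  apply le_sqrt_of_sq_le
  have h : ∀ i ∈ e, w e ≤ vw G w i := by
    rintro i ⟨j, rfl⟩
    exact Finset.single_le_sum (f := fun j => w s(i, j))
      (fun k hk => (hw _ (by simpa using hk)).le) (by simpa using he)
  have h0 := (hw e he).le
  induction e using Sym2.ind with
  | _ i j =>
    rw [sq]
    have hi := h i (Sym2.mem_mk_left i j)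
    exact mul_le_mul hi (h j (Sym2.mem_mk_right i j)) h0 (h0.trans hi)

lemma div_sum_le_edgeRatio (hG : G.Connected) {w : Sym2 V → ℝ}
    (hw : ∀ e ∈ G.edgeFinset, 0 < w e) {e : Sym2 V} (he : e ∈ G.edgeFinset) :
    w e / ∑ g ∈ G.edgeFinset, w g ≤ edgeRatio G w e := by
  refine div_le_div_of_nonneg_left (hw e he).le (sqrt_pos.2 (sprod_vw_pos hG hw he)) ?_
  rw [sqrt_le_left (Finset.sum_nonneg fun g hg => (hw g hg).le), sq]
  have hv := vw_pos hG he hw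
  induction e using Sym2.ind with
  | _ i j =>
    exact mul_le_mul (vw_le_sum hw i) (vw_le_sum hw j) (hv j).le
      (Finset.sum_nonneg fun g hg => (hw g hg).le)

lemma neg_mul_log_le {x t : ℝ} (hx : 0 < x) (ht : 0 < t) :
    -(x * log x) ≤ (x ^ (1 - t) - x ^ (1 : ℝ)) / t := by
  have h := add_one_le_exp (-(t * log x))
  have h1 : x ^ (1 - t) = x * exp (-(t * log x)) := by
    rw [rpow_sub hx, rpow_one, rpow_def_of_pos hx, exp_neg, div_eq_mul_inv, mul_comm t]
  rw [le_div_iff₀ ht, h1, rpow_one]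
  nlinarith

/-- The moments of the edge ratio under the mixing measure. -/
def ratioMoment (G : SimpleGraph V) [DecidableRel G.Adj] (x : V) (a : Sym2 V → ℝ) (e : Sym2 V)
    (θ : ℝ) : ℝ :=
  Gamma (a e + θ) / Gamma (a e) *
    sprod (fun v => Gamma (bwt G x a v) / Gamma (bwt G x a v + θ / 2)) e / 2 ^ θ

lemma Znorm_addWeight (hG : G.Connected) (x : V) {a : Sym2 V → ℝ}
    (ha : ∀ e ∈ G.edgeFinset, 0 < a e) {e : Sym2 V} (he : e ∈ G.edgeFinset) (θ : ℝ) :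
    Znorm G x (addWeight a e θ) = ratioMoment G x a e θ * Znorm G x a := by
  have hb : ∀ v, Gamma (bwt G x a v) ≠ 0 := fun v =>
    (Gamma_pos_of_pos (bwt_pos hG he ha x v)).ne'
  have h1 : ∏ g ∈ G.edgeFinset, Gamma (addWeight a e θ g) =
      (∏ g ∈ G.edgeFinset, Gamma (a g)) * (Gamma (a e + θ) / Gamma (a e)) := by
    rw [← Finset.mul_prod_erase _ _ he, ← Finset.mul_prod_erase _ (fun g => Gamma (a g)) he]
    have h : ∏ g ∈ G.edgeFinset.erase e, Gamma (addWeight a e θ g) =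
        ∏ g ∈ G.edgeFinset.erase e, Gamma (a g) :=
      Finset.prod_congr rfl fun g hg => by simp [addWeight, Finset.ne_of_mem_erase hg]
    rw [h, addWeight, if_pos rfl]
    field_simp [(Gamma_pos_of_pos (ha e he)).ne']
  have h2 : (∏ v, Gamma (bwt G x (addWeight a e θ) v))⁻¹ =
      (∏ v, Gamma (bwt G x a v))⁻¹ *
        sprod (fun v => Gamma (bwt G x a v) / Gamma (bwt G x a v + θ / 2)) e := by
    rw [← prod_ite_mem_edge he, ← Finset.prod_inv_distrib, ← Finset.prod_inv_distrib,
      ← Finset.prod_mul_distrib]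
    refine Finset.prod_congr rfl fun v _ => ?_
    rw [bwt_addWeight x a he]
    split_ifs
    · field_simp [hb v]
    · simp
  have h3 : ∑ g ∈ G.edgeFinset, addWeight a e θ g = ∑ g ∈ G.edgeFinset, a g + θ := by
    simp only [addWeight, Finset.sum_add_distrib, Finset.sum_ite_eq', he, if_true]
  rw [Znorm, div_eq_mul_inv (∏ g ∈ G.edgeFinset, _), h1, h2, h3, ← add_assoc,
    rpow_add two_pos, Znorm, ratioMoment]
  ring

lemma magicDensity_addWeight (hG : G.Connected) (x : V) {a : Sym2 V → ℝ}
    (ha : ∀ e ∈ G.edgeFinset, 0 < a e) {e : Sym2 V} (he : e ∈ G.edgeFinset) {θ : ℝ}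
    (hθ : 0 ≤ θ) {w : Sym2 V → ℝ} (hw : ∀ e ∈ G.edgeFinset, 0 < w e) :
    magicDensity G x a w * edgeRatio G w e ^ θ =
      ratioMoment G x a e θ * magicDensity G x (addWeight a e θ) w := by
  have hv := vw_pos hG he hw
  have hZ := Znorm_pos hG he x ha
  have hZ' := Znorm_pos hG he x (addWeight_pos ha e hθ)
  have h1 : ∏ g ∈ G.edgeFinset, w g ^ (addWeight a e θ g - 1) =
      (∏ g ∈ G.edgeFinset, w g ^ (a g - 1)) * w e ^ θ := by
    rw [← Finset.mul_prod_erase _ _ he, ← Finset.mul_prod_erase _ (fun g => w g ^ (a g - 1)) he]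
    have h : ∏ g ∈ G.edgeFinset.erase e, w g ^ (addWeight a e θ g - 1) =
        ∏ g ∈ G.edgeFinset.erase e, w g ^ (a g - 1) :=
      Finset.prod_congr rfl fun g hg => by simp [addWeight, Finset.ne_of_mem_erase hg]
    rw [h, addWeight, if_pos rfl, add_sub_right_comm, rpow_add (hw e he)]
    ring
  have h2 : ∏ v, vw G w v ^ (-bwt G x (addWeight a e θ) v) =
      (∏ v, vw G w v ^ (-bwt G x a v)) * (√(sprod (vw G w) e) ^ θ)⁻¹ := by
    have hs : (√(sprod (vw G w) e) ^ θ)⁻¹ = ∏ v, (if v ∈ e then vw G w v else 1) ^ (-(θ / 2)) := by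
      rw [Real.finsetProd_rpow _ _ fun v _ => ?_, prod_ite_mem_edge he, sqrt_eq_rpow,
        ← rpow_mul (sprod_vw_pos hG hw he).le, ← rpow_neg (sprod_vw_pos hG hw he).le]
      · ring_nf
      · split_ifs
        exacts [(hv v).le, zero_le_one]
    rw [hs, ← Finset.prod_mul_distrib]
    refine Finset.prod_congr rfl fun v _ => ?_
    rw [bwt_addWeight x a he]
    split_ifs
    · rw [neg_add, rpow_add (hv v)]
    · simp
  rw [magicDensity_eq hG he x _ hw, magicDensity_eq hG he x _ hw, h1, h2, edgeRatio,
    div_rpow (hw e he).le (sqrt_nonneg _), Znorm_addWeight hG x ha he]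
  have hm : ratioMoment G x a e θ ≠ 0 := by
    rintro h
    rw [Znorm_addWeight hG x ha he, h, zero_mul] at hZ'
    exact hZ'.false
  field_simp

lemma hasDerivAt_Gamma_digamma {x : ℝ} (hx : 0 < x) :
    HasDerivAt Gamma (Gamma x * digamma x) x := by
  have hd : DifferentiableAt ℝ Gamma x :=
    differentiableAt_Gamma fun m => by
      have : (0 : ℝ) ≤ m := m.cast_nonneg
      linarith
  have hne := (Gamma_pos_of_pos hx).ne'
  have h : digamma x = deriv Gamma x / Gamma x := (hd.hasDerivAt.log hne).deriv
  rw [h, mul_div_cancel₀ _ hne]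
  exact hd.hasDerivAt

lemma hasDerivAt_ratioMoment_one (hG : G.Connected) (x : V) {a : Sym2 V → ℝ}
    (ha : ∀ e ∈ G.edgeFinset, 0 < a e) {e : Sym2 V} (he : e ∈ G.edgeFinset) :
    HasDerivAt (ratioMoment G x a e)
      (-((a e / 2 * sprod (fun v => Gamma (bwt G x a v) / Gamma (bwt G x a v + 1 / 2)) e) *
        (log 2 + ssum (fun v => digamma (bwt G x a v + 1 / 2) / 2) e - digamma (a e + 1)))) 1 := by
  have hb := bwt_pos hG he ha x
  have hae := ha e he
  have hΓa : Gamma (a e) ≠ 0 := (Gamma_pos_of_pos hae).ne'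
  have hnum : HasDerivAt (fun θ => Gamma (a e + θ) / Gamma (a e))
      (a e * digamma (a e + 1)) 1 := by
    have h := ((hasDerivAt_Gamma_digamma (x := a e + 1) (by linarith)).comp_const_add
      (a e) 1).div_const (Gamma (a e))
    refine h.congr_deriv ?_
    rw [Gamma_add_one hae.ne']
    field_simp
  have hden : ∀ v, HasDerivAt (fun θ => Gamma (bwt G x a v) / Gamma (bwt G x a v + θ / 2))
      (-(Gamma (bwt G x a v) / Gamma (bwt G x a v + 1 / 2) *
        (digamma (bwt G x a v + 1 / 2) / 2))) 1 := by
    intro v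
    have hp : 0 < bwt G x a v + 1 / 2 := by linarith [hb v]
    have hne := (Gamma_pos_of_pos hp).ne'
    have hin : HasDerivAt (fun θ : ℝ => bwt G x a v + θ / 2) (1 / 2) 1 :=
      ((hasDerivAt_id (1 : ℝ)).div_const 2).const_add _
    have hΓ : HasDerivAt (fun θ : ℝ => Gamma (bwt G x a v + θ / 2))
        (Gamma (bwt G x a v + 1 / 2) * digamma (bwt G x a v + 1 / 2) * (1 / 2)) 1 :=
      HasDerivAt.comp (h₂ := Gamma) 1 (hasDerivAt_Gamma_digamma hp) hin
    refine ((hasDerivAt_const (1 : ℝ) (Gamma (bwt G x a v))).div hΓ hne).congr_deriv ?_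
    field_simp
    ring
  have hpow : HasDerivAt (fun θ : ℝ => (2 : ℝ) ^ θ) (2 * log 2) 1 := by
    have h := (hasDerivAt_id (1 : ℝ)).const_rpow (a := 2) two_pos
    simpa [mul_comm] using h
  induction e using Sym2.ind with
  | _ i j =>
    have h := (hnum.mul ((hden i).mul (hden j))).div hpow (by simp)
    refine h.congr_deriv ?_
    simp only [sprod, ssum, Sym2.lift_mk, Pi.mul_apply, rpow_one, Gamma_add_one hae.ne']
    field_simp
    ring

end EdgeRatio

section Mixing

variable {G : SimpleGraph V} [DecidableRel G.Adj]

lemma measurable_vw (G : SimpleGraph V) [DecidableRel G.Adj] (v : V) :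
    Measurable fun w : Sym2 V → ℝ => vw G w v :=
  Finset.measurable_sum _ fun _ _ => measurable_pi_apply _

lemma measurable_edgeRatio (G : SimpleGraph V) [DecidableRel G.Adj] (e : Sym2 V) :
    Measurable fun w : Sym2 V → ℝ => edgeRatio G w e := by
  refine (measurable_pi_apply e).div (Measurable.sqrt ?_)
  induction e using Sym2.ind with
  | _ i j => exact (measurable_vw G i).mul (measurable_vw G j)

lemma measurable_magicDensity (G : SimpleGraph V) [DecidableRel G.Adj] (x : V)
    (B : Sym2 V → ℝ) : Measurable (magicDensity G x B) := by
  have hv := measurable_vw G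
  have hτ : Measurable fun w : Sym2 V → ℝ => tau G w :=
    Finset.measurable_sum _ fun _ _ => Finset.measurable_prod _ fun _ _ => measurable_pi_apply _
  unfold magicDensity
  refine (((measurable_const.mul ((hv x).pow_const _)).mul ?_).div ?_).mul hτ.sqrt
  · exact Finset.measurable_prod _ fun e _ => (measurable_pi_apply e).pow_const _
  · exact Finset.measurable_prod _ fun v _ => (hv v).pow_const _

lemma measurable_pinExt (G : SimpleGraph V) [DecidableRel G.Adj] (e0 : Sym2 V) :
    Measurable (pinExt G e0) := by
  refine measurable_pi_lambda _ fun e => ?_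
  unfold pinExt
  split_ifs
  exacts [measurable_const, measurable_pi_apply _, measurable_const]

lemma measurableSet_forall_pos (α : Type*) [Fintype α] :
    MeasurableSet {u : α → ℝ | ∀ i, 0 < u i} := by
  simp only [Set.ofPred_forall]
  exact MeasurableSet.iInter fun i => measurableSet_lt measurable_const (measurable_pi_apply i)

lemma mixing_eq (G : SimpleGraph V) [DecidableRel G.Adj] (e0 : Sym2 V) (x : V)
    (B : Sym2 V → ℝ) :
    mixing G e0 x B = Measure.map (pinExt G e0)
      (((volume : Measure (Epin G e0 → ℝ)).restrict {u | ∀ i, 0 < u i}).withDensity fun u =>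
        ENNReal.ofReal (magicDensity G x B (pinExt G e0 u))) := by
  rw [mixing, ← withDensity_indicator (measurableSet_forall_pos _)]
  congr 2
  ext u
  rw [Set.indicator_apply]
  simp only [pinExt_pos_iff, Set.mem_ofPred_eq]
  split_ifs <;> simp

lemma lintegral_mixing (G : SimpleGraph V) [DecidableRel G.Adj] (e0 : Sym2 V) (x : V)
    (B : Sym2 V → ℝ) {f : (Sym2 V → ℝ) → ℝ≥0∞} (hf : Measurable f) :
    ∫⁻ w, f w ∂mixing G e0 x B = ∫⁻ u in {u : Epin G e0 → ℝ | ∀ i, 0 < u i},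
      ENNReal.ofReal (magicDensity G x B (pinExt G e0 u)) * f (pinExt G e0 u) := by
  have hp := measurable_pinExt G e0
  rw [mixing_eq, lintegral_map hf hp]
  exact lintegral_withDensity_eq_lintegral_mul _
    ((measurable_magicDensity G x B).comp hp).ennreal_ofReal (hf.comp hp)

lemma ae_mixing_pos (G : SimpleGraph V) [DecidableRel G.Adj] (e0 : Sym2 V) (x : V)
    (B : Sym2 V → ℝ) : ∀ᵐ w ∂mixing G e0 x B, ∀ e ∈ G.edgeFinset, 0 < w e := by
  rw [mixing_eq]
  have hset : MeasurableSet {w : Sym2 V → ℝ | ∀ e ∈ G.edgeFinset, 0 < w e} := by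
    simp only [Set.ofPred_forall]
    exact MeasurableSet.iInter fun e => MeasurableSet.iInter fun _ =>
      measurableSet_lt measurable_const (measurable_pi_apply e)
  refine (ae_map_iff (measurable_pinExt G e0).aemeasurable hset).2 ?_
  refine (withDensity_absolutelyContinuous _ _).ae_le ?_
  filter_upwards [ae_restrict_mem (measurableSet_forall_pos _)] with u hu
  exact pinExt_pos_iff.2 hu

lemma magicDensity_nonneg (hG : G.Connected) {e0 : Sym2 V} (he0 : e0 ∈ G.edgeFinset) (x : V)
    {B : Sym2 V → ℝ} (hB : ∀ e ∈ G.edgeFinset, 0 < B e) {w : Sym2 V → ℝ}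
    (hw : ∀ e ∈ G.edgeFinset, 0 < w e) : 0 ≤ magicDensity G x B w := by
  have hZ := Znorm_pos hG he0 x hB
  have hv := vw_pos hG he0 hw
  rw [magicDensity_eq hG he0 x B hw]
  refine mul_nonneg (inv_pos.2 hZ).le (mul_nonneg (mul_nonneg ?_ (sqrt_nonneg _)) ?_)
  · exact Finset.prod_nonneg fun e he => rpow_nonneg (hw e he).le _
  · exact Finset.prod_nonneg fun v _ => rpow_nonneg (hv v).le _

lemma ratioMoment_pos (hG : G.Connected) (x : V) {a : Sym2 V → ℝ}
    (ha : ∀ e ∈ G.edgeFinset, 0 < a e) {e : Sym2 V} (he : e ∈ G.edgeFinset) {θ : ℝ}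
    (hθ : 0 ≤ θ) : 0 < ratioMoment G x a e θ := by
  have h := Znorm_pos hG he x (addWeight_pos ha e hθ)
  rw [Znorm_addWeight hG x ha he] at h
  exact pos_of_mul_pos_left h (Znorm_pos hG he x ha).le

lemma lintegral_edgeRatio_rpow (hG : G.Connected) {e0 : Sym2 V} (he0 : e0 ∈ G.edgeFinset) (x : V)
    {a : Sym2 V → ℝ} (ha : ∀ e ∈ G.edgeFinset, 0 < a e) {e : Sym2 V} (he : e ∈ G.edgeFinset)
    {θ : ℝ} (hθ : 0 ≤ θ) :
    ∫⁻ w, ENNReal.ofReal (edgeRatio G w e ^ θ) ∂mixing G e0 x a =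
      ENNReal.ofReal (ratioMoment G x a e θ) := by
  have hm := ratioMoment_pos hG x ha he hθ
  rw [lintegral_mixing G e0 x a ((measurable_edgeRatio G e).pow_const θ).ennreal_ofReal]
  have h : ∀ u ∈ {u : Epin G e0 → ℝ | ∀ i, 0 < u i},
      ENNReal.ofReal (magicDensity G x a (pinExt G e0 u)) *
        ENNReal.ofReal (edgeRatio G (pinExt G e0 u) e ^ θ) =
      ENNReal.ofReal (ratioMoment G x a e θ) *
        ENNReal.ofReal (magicDensity G x (addWeight a e θ) (pinExt G e0 u)) := by
    intro u hu
    have hw := pinExt_pos_iff.2 hu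
    rw [← ENNReal.ofReal_mul (magicDensity_nonneg hG he0 x ha hw), ← ENNReal.ofReal_mul hm.le,
      magicDensity_addWeight hG x ha he hθ hw]
  rw [setLIntegral_congr_fun (measurableSet_forall_pos _) h,
    lintegral_const_mul' _ _ ENNReal.ofReal_ne_top,
    lintegral_magicDensity hG he0 x (addWeight_pos ha e hθ), mul_one]

lemma edgeRatio_rpow_ae_nonneg (hG : G.Connected) (e0 : Sym2 V) (x : V) (a : Sym2 V → ℝ)
    {e : Sym2 V} (he : e ∈ G.edgeFinset) (θ : ℝ) :
    0 ≤ᵐ[mixing G e0 x a] fun w => edgeRatio G w e ^ θ := by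
  filter_upwards [ae_mixing_pos G e0 x a] with w hw
  exact rpow_nonneg (edgeRatio_pos hG hw he).le θ

lemma integrable_edgeRatio_rpow (hG : G.Connected) {e0 : Sym2 V} (he0 : e0 ∈ G.edgeFinset)
    (x : V) {a : Sym2 V → ℝ} (ha : ∀ e ∈ G.edgeFinset, 0 < a e) {e : Sym2 V}
    (he : e ∈ G.edgeFinset) {θ : ℝ} (hθ : 0 ≤ θ) :
    Integrable (fun w => edgeRatio G w e ^ θ) (mixing G e0 x a) := by
  have hmeas := ((measurable_edgeRatio G e).pow_const θ).aestronglyMeasurable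
    (μ := mixing G e0 x a)
  refine (lintegral_ofReal_ne_top_iff_integrable hmeas
    (edgeRatio_rpow_ae_nonneg hG e0 x a he θ)).1 ?_
  rw [lintegral_edgeRatio_rpow hG he0 x ha he hθ]
  exact ENNReal.ofReal_ne_top

lemma integral_edgeRatio_rpow (hG : G.Connected) {e0 : Sym2 V} (he0 : e0 ∈ G.edgeFinset)
    (x : V) {a : Sym2 V → ℝ} (ha : ∀ e ∈ G.edgeFinset, 0 < a e) {e : Sym2 V}
    (he : e ∈ G.edgeFinset) {θ : ℝ} (hθ : 0 ≤ θ) :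
    ∫ w, edgeRatio G w e ^ θ ∂mixing G e0 x a = ratioMoment G x a e θ := by
  rw [integral_eq_lintegral_of_nonneg_ae (edgeRatio_rpow_ae_nonneg hG e0 x a he θ)
    ((measurable_edgeRatio G e).pow_const θ).aestronglyMeasurable,
    lintegral_edgeRatio_rpow hG he0 x ha he hθ,
    ENNReal.toReal_ofReal (ratioMoment_pos hG x ha he hθ).le]

lemma neg_integral_log_edgeRatio_le (hG : G.Connected) {e0 : Sym2 V} (he0 : e0 ∈ G.edgeFinset)
    (x : V) {a : Sym2 V → ℝ} (ha : ∀ e ∈ G.edgeFinset, 0 < a e) {t : ℝ} (ht : 0 < t)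
    (ht1 : t ≤ 1) :
    (-∫ w, (∑ e ∈ G.edgeFinset, (w e / ∑ g ∈ G.edgeFinset, w g) *
        log (w e / √(sprod (vw G w) e))) ∂mixing G e0 x a) ≤
      ∑ e ∈ G.edgeFinset, (ratioMoment G x a e (1 - t) - ratioMoment G x a e 1) / t := by
  have hint : ∀ e ∈ G.edgeFinset, Integrable
      (fun w => (edgeRatio G w e ^ (1 - t) - edgeRatio G w e ^ (1 : ℝ)) / t)
      (mixing G e0 x a) := fun e he =>
    ((integrable_edgeRatio_rpow hG he0 x ha he (by linarith)).sub
      (integrable_edgeRatio_rpow hG he0 x ha he zero_le_one)).div_const t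
  have hrhs : ∑ e ∈ G.edgeFinset, (ratioMoment G x a e (1 - t) - ratioMoment G x a e 1) / t =
      ∫ w, ∑ e ∈ G.edgeFinset, (edgeRatio G w e ^ (1 - t) - edgeRatio G w e ^ (1 : ℝ)) / t
        ∂mixing G e0 x a := by
    rw [integral_finsetSum _ hint]
    refine Finset.sum_congr rfl fun e he => ?_
    rw [integral_div, integral_sub (integrable_edgeRatio_rpow hG he0 x ha he (by linarith))
      (integrable_edgeRatio_rpow hG he0 x ha he zero_le_one),
      integral_edgeRatio_rpow hG he0 x ha he (by linarith),
      integral_edgeRatio_rpow hG he0 x ha he zero_le_one]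
  rw [hrhs, ← integral_neg]
  refine integral_mono_of_nonneg ?_ (integrable_finsetSum _ hint) ?_
  · filter_upwards [ae_mixing_pos G e0 x a] with w hw
    refine neg_nonneg.2 (Finset.sum_nonpos fun e he => mul_nonpos_of_nonneg_of_nonpos
      (div_nonneg (hw e he).le (Finset.sum_nonneg fun g hg => (hw g hg).le)) ?_)
    exact log_nonpos (edgeRatio_pos hG hw he).le (edgeRatio_le_one hG hw he)
  · filter_upwards [ae_mixing_pos G e0 x a] with w hw
    rw [← Finset.sum_neg_distrib]
    refine Finset.sum_le_sum fun e he => le_trans ?_ (neg_mul_log_le (edgeRatio_pos hG hw he) ht)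
    exact neg_le_neg (mul_le_mul_of_nonpos_right (div_sum_le_edgeRatio hG hw he)
      (log_nonpos (edgeRatio_pos hG hw he).le (edgeRatio_le_one hG hw he)))

end Mixing

/-- Upper bound on the ERRW entropy rate. With
`r(v0,A) := −∫ Σ_{{i,j}∈E} (w_{ij}/Σ_e w_e) log(w_{ij}/√(w_i w_j)) dμ_{v0,A}(w)`,
one has
`r(v0,A) ≤ Σ_{e={i,j}∈E} ((a_e/2)·Γ(b_i)/Γ(b_i+1/2)·Γ(b_j)/Γ(b_j+1/2))
  ·(log 2 + ½Ψ(b_i+1/2) + ½Ψ(b_j+1/2) − Ψ(a_e+1))`. -/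
theorem entropy_rate_upper_bound
    {V : Type*} [Fintype V] [DecidableEq V]
    (G : SimpleGraph V) [DecidableRel G.Adj] (hG : G.Connected)
    (v0 : V) (e0 : Sym2 V) (he0 : e0 ∈ G.edgeFinset)
    (a : Sym2 V → ℝ) (ha : ∀ e ∈ G.edgeFinset, 0 < a e) :
    (-∫ w, (∑ e ∈ G.edgeFinset,
        (w e / ∑ g ∈ G.edgeFinset, w g) *
          Real.log (w e / Real.sqrt (sprod (vw G w) e))) ∂(mixing G e0 v0 a))
      ≤ ∑ e ∈ G.edgeFinset,
          (a e / 2 *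
            sprod (fun v => Real.Gamma (bwt G v0 a v) /
              Real.Gamma (bwt G v0 a v + 1 / 2)) e) *
          (Real.log 2 + ssum (fun v => digamma (bwt G v0 a v + 1 / 2) / 2) e
            - digamma (a e + 1)) := by
  have hlim : Tendsto (fun t : ℝ => ∑ e ∈ G.edgeFinset,
      (ratioMoment G v0 a e (1 - t) - ratioMoment G v0 a e 1) / t) (nhdsWithin 0 (Set.Ioi 0))
      (nhds (∑ e ∈ G.edgeFinset,
          (a e / 2 *
            sprod (fun v => Real.Gamma (bwt G v0 a v) /
              Real.Gamma (bwt G v0 a v + 1 / 2)) e) *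
          (Real.log 2 + ssum (fun v => digamma (bwt G v0 a v + 1 / 2) / 2) e
            - digamma (a e + 1)))) := by
    refine tendsto_finsetSum _ fun e he => ?_
    have hm := hasDerivAt_ratioMoment_one hG v0 ha he
    have hs : HasDerivAt (fun t : ℝ => ratioMoment G v0 a e (1 - t)) _ 0 :=
      HasDerivAt.comp_const_sub 1 0 (by rwa [sub_zero])
    rw [neg_neg] at hs
    refine (hs.tendsto_slope_zero_right).congr fun t => ?_
    simp only [zero_add, sub_zero, smul_eq_mul]
    ring
  refine ge_of_tendsto hlim ?_
  filter_upwards [Ioc_mem_nhdsGT (zero_lt_one' ℝ)] with t ht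
  exact neg_integral_log_edgeRatio_le hG he0 v0 ha ht.1 ht.2

end ERRW
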